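/- arXiv:1805.02426 — 2 statements merged into one kernel-verified Lean document; each statement's English description precedes it below -/
import Mathlib

section
/- Moderate-sized key achievability: if 0 < p < q < 1/2, ε_d ∈ (0,1), σ > 0 is a constant with I_B(p,q) + σ/t(q,ε_d) > I_J(q), then for every δ > 0 the relative throughput t(q,ε_d)·I_B(p,q) − δ is achievable with key sizes Δ(n) = ⌈σ√n + 6 log₂ n⌉: there exists a (1 − ε_d)-covert sequence of codes with Δ(n) key bits, (log₂ N_n)/√n ≥ t(q,ε_d)·I_B(p,q) − δ for all sufficiently large n, and P_err → 0. In particular, for any key sizes satisfying Δ(n)/√n → ∞ this holds for all 0 < p < q < 1/2 without further conditions. -/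
/-!
Covert communication over an adversarially jammed binary channel.

A code with blocklength `n`, `N` messages and `Δ` key bits consists of an
encoder `Fin N → key → {0,1}^n` and a decoder `{0,1}^n → key → {0,…,N}`
(we model the output `0` ("declare silence") as `Option.none`).
When Alice is silent she transmits the all-zeros vector.
James observes `Z = X ⊕ S̄` with `S̄` i.i.d. Bernoulli(q); a jamming strategy is a
stochastic kernel from observations `z` to jamming vectors `s` of Hamming
weight at most `p·n`.  Bob receives `Y = X ⊕ S`.
-/

namespace CovertComm

open Finset Filter

/-- Binary vectors of length `n`. -/
abbrev BV (n : ℕ) := Fin n → Bool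

/-- Coordinatewise XOR of binary vectors. -/
def vxor {n : ℕ} (x y : BV n) : BV n := fun i => Bool.xor (x i) (y i)

/-- Hamming weight. -/
def wt {n : ℕ} (x : BV n) : ℕ := (Finset.univ.filter fun i => x i = true).card

/-- Probability that an i.i.d. Bernoulli(q) noise vector equals `z`. -/
noncomputable def noiseP {n : ℕ} (q : ℝ) (z : BV n) : ℝ :=
  ∏ i, if z i then q else 1 - q

/-- A code: encoder and decoder.  Decoder output `none` means "declare 0 (silence)". -/
structure Code (n N Δ : ℕ) where
  enc : Fin N → BV Δ → BV n
  dec : BV n → BV Δ → Option (Fin N)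

/-- A jamming strategy: a stochastic kernel `W z s`, supported on jamming
vectors of Hamming weight at most `p·n`. -/
structure Jammer (n : ℕ) (p : ℝ) where
  W : BV n → BV n → ℝ
  nonneg : ∀ z s, 0 ≤ W z s
  sum_one : ∀ z, ∑ s : BV n, W z s = 1
  wt_le : ∀ z s, W z s ≠ 0 → (wt s : ℝ) ≤ p * n

/-- False-alarm probability of detector `Φ`: when `T = 0`, `Z` is pure
Bernoulli(q) noise. -/
noncomputable def PFA {n : ℕ} (q : ℝ) (Φ : BV n → Bool) : ℝ :=
  ∑ z : BV n, noiseP q z * (if Φ z then (1 : ℝ) else 0)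

/-- Missed-detection probability of detector `Φ`: when `T = 1`, the message and
key are uniform and `Z = Enc(M,K) ⊕ S̄`. -/
noncomputable def PMD {n N Δ : ℕ} (q : ℝ) (C : Code n N Δ) (Φ : BV n → Bool) : ℝ :=
  (1 / ((N : ℝ) * 2 ^ Δ)) * ∑ m : Fin N, ∑ k : BV Δ, ∑ z : BV n,
    noiseP q (vxor z (C.enc m k)) * (if Φ z then (0 : ℝ) else 1)

/-- Probability of decoding error when Alice is active:
`P(Dec(Enc(M,K) ⊕ S, K) ≠ M | T = 1)` with uniform `M, K`, where
`S` is drawn from `J.W` applied to James' observation `Enc(M,K) ⊕ S̄`. -/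
noncomputable def errActive {n N Δ : ℕ} {p : ℝ} (q : ℝ) (C : Code n N Δ)
    (J : Jammer n p) : ℝ :=
  (1 / ((N : ℝ) * 2 ^ Δ)) * ∑ m : Fin N, ∑ k : BV Δ, ∑ zb : BV n,
    noiseP q zb * ∑ s : BV n, J.W (vxor (C.enc m k) zb) s *
      (if C.dec (vxor (C.enc m k) s) k = some m then (0 : ℝ) else 1)

/-- Probability of decoding error when Alice is silent:
`P(Dec(S, K) ≠ 0 | T = 0)`, where `S` is drawn from `J.W` applied to the pure
noise observation. -/
noncomputable def errSilent {n N Δ : ℕ} {p : ℝ} (q : ℝ) (C : Code n N Δ)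
    (J : Jammer n p) : ℝ :=
  (1 / (2 ^ Δ : ℝ)) * ∑ k : BV Δ, ∑ zb : BV n,
    noiseP q zb * ∑ s : BV n, J.W zb s *
      (if C.dec s k = Option.none then (0 : ℝ) else 1)

/-- `P_err`: worst case over jamming strategies of the sum of the two error
probabilities. -/
noncomputable def Perr {n N Δ : ℕ} (p q : ℝ) (C : Code n N Δ) : ℝ :=
  ⨆ J : Jammer n p, (errSilent q C J + errActive q C J)

/-- `min_Φ (P_FA(Φ) + P_MD(Φ))` for a given code. -/
noncomputable def covertGap {n N Δ : ℕ} (q : ℝ) (C : Code n N Δ) : ℝ :=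
  ⨅ Φ : BV n → Bool, (PFA q Φ + PMD q C Φ)

/-- A sequence of codes is `(1 − εd)`-covert if
`liminf_n min_Φ (P_FA + P_MD) ≥ 1 − εd`. -/
def IsCovertSeq (q εd : ℝ) (N Δ : ℕ → ℕ) (C : ∀ n, Code n (N n) (Δ n)) : Prop :=
  1 - εd ≤ Filter.liminf (fun n => covertGap q (C n)) Filter.atTop

/-- Relative throughput `r` is achievable with key sizes `Δ(n)`: there is a
`(1 − εd)`-covert sequence of codes with `Δ(n)` key bits, relative throughput
at least `r` at every (positive) blocklength, and `P_err → 0`. -/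
def Achievable (p q εd : ℝ) (Δ : ℕ → ℕ) (r : ℝ) : Prop :=
  ∃ (N : ℕ → ℕ) (C : ∀ n, Code n (N n) (Δ n)),
    IsCovertSeq q εd N Δ C ∧
    (∀ n : ℕ, 1 ≤ n → r ≤ Real.logb 2 (N n) / Real.sqrt n) ∧
    Filter.Tendsto (fun n => Perr p q (C n)) Filter.atTop (nhds 0)

/-- The Gaussian `Q`-function. -/
noncomputable def Qfun (x : ℝ) : ℝ :=
  ∫ u in Set.Ioi x, Real.exp (-u ^ 2 / 2) / Real.sqrt (2 * Real.pi)

/-- Inverse of the `Q`-function. -/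
noncomputable def Qinv : ℝ → ℝ := Function.invFun Qfun

/-- The code-weight parameter `t(q, εd)`. -/
noncomputable def tpar (q εd : ℝ) : ℝ :=
  2 * Real.sqrt (q * (1 - q)) / (1 - 2 * q) * Qinv ((1 - εd) / 2)

/-- Weight-normalized mutual information for Bob, `I_B(p,q)`. -/
noncomputable def IB (p q : ℝ) : ℝ :=
  p * (q - 1) / q *
      Real.logb 2 ((q - p + p * q) * (1 - p) / (p ^ 2 * (1 - q)))
    + Real.logb 2 ((q - p + p * q) / (p * q))

/-- Weight-normalized mutual information for James, `I_J(q)`. -/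
noncomputable def IJ (q : ℝ) : ℝ := (1 - 2 * q) * Real.logb 2 ((1 - q) / q)

end CovertComm

namespace CovertComm

open Finset

/-- Product of single-letter weights. -/
def prodWeight {ι α : Type*} [Fintype ι] (w : α → ℝ) (c : ι → α) : ℝ := ∏ i, w (c i)

lemma prodWeight_nonneg {ι α : Type*} [Fintype ι] {w : α → ℝ} (hw : ∀ a, 0 ≤ w a) (c : ι → α) :
    0 ≤ prodWeight w c :=
  prod_nonneg fun _ _ => hw _

section ProductWeights

variable {ι α : Type*} [Fintype ι] [Fintype α] [DecidableEq ι]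

lemma sum_prod_apply (g : ι → α → ℝ) : ∑ c : ι → α, ∏ i, g i (c i) = ∏ i, ∑ a, g i a :=
  (Fintype.prod_sum g).symm

lemma sum_prodWeight (w : α → ℝ) :
    ∑ c : ι → α, prodWeight w c = (∑ a, w a) ^ Fintype.card ι := by
  simp [prodWeight, sum_prod_apply (fun _ => w)]

lemma sum_prodWeight_mul_apply (w F : α → ℝ) (i : ι) :
    ∑ c : ι → α, prodWeight w c * F (c i)
      = (∑ a, w a * F a) * (∑ a, w a) ^ (Fintype.card ι - 1) := by
  have h : ∀ c : ι → α, prodWeight w c * F (c i)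
      = ∏ l, (if l = i then fun a => w a * F a else w) (c l) := by
    intro c
    rw [prodWeight, ← mul_prod_erase univ _ (mem_univ i),
      ← mul_prod_erase univ (fun l => (if l = i then fun a => w a * F a else w) (c l)) (mem_univ i)]
    have h1 : ∏ l ∈ univ.erase i, (if l = i then fun a => w a * F a else w) (c l)
        = ∏ l ∈ univ.erase i, w (c l) :=
      prod_congr rfl fun l hl => by simp [ne_of_mem_erase hl]
    rw [h1]
    simp
    ring
  simp_rw [h]
  rw [sum_prod_apply, ← mul_prod_erase univ _ (mem_univ i),
    prod_congr rfl (g := fun _ => ∑ a, w a)]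
  · simp [card_erase_of_mem]
  · intro l hl; simp [ne_of_mem_erase hl]

lemma sum_prodWeight_mul_apply_apply (w : α → ℝ) (F : α → α → ℝ) {i j : ι} (hij : i ≠ j) :
    ∑ c : ι → α, prodWeight w c * F (c i) (c j)
      = (∑ a, ∑ b, w a * w b * F a b) * (∑ a, w a) ^ (Fintype.card ι - 2) := by
  classical
  have key : ∀ a : α, ∑ c : ι → α, prodWeight w c * ((if c i = a then 1 else 0) * F a (c j))
      = (∑ b, w a * w b * F a b) * (∑ a, w a) ^ (Fintype.card ι - 2) := by
    intro a
    have h : ∀ c : ι → α, prodWeight w c * ((if c i = a then 1 else 0) * F a (c j))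
        = ∏ l, (if l = i then fun b => w b * (if b = a then 1 else 0)
            else if l = j then fun b => w b * F a b else w) (c l) := by
      intro c
      rw [prodWeight, ← mul_prod_erase univ _ (mem_univ i),
        ← mul_prod_erase (univ.erase i) _ (mem_erase.2 ⟨hij.symm, mem_univ j⟩),
        ← mul_prod_erase univ (fun l => (if l = i then fun b => w b * (if b = a then 1 else 0)
            else if l = j then fun b => w b * F a b else w) (c l)) (mem_univ i),
        ← mul_prod_erase (univ.erase i) (fun l => (if l = i then
            fun b => w b * (if b = a then 1 else 0)
            else if l = j then fun b => w b * F a b else w) (c l))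
            (mem_erase.2 ⟨hij.symm, mem_univ j⟩)]
      have h1 : ∏ l ∈ (univ.erase i).erase j, (if l = i then
            fun b => w b * (if b = a then 1 else 0)
            else if l = j then fun b => w b * F a b else w) (c l)
          = ∏ l ∈ (univ.erase i).erase j, w (c l) :=
        prod_congr rfl fun l hl => by
          simp [ne_of_mem_erase hl, ne_of_mem_erase (mem_of_mem_erase hl)]
      rw [h1]
      simp only [hij.symm, if_true, if_false]
      ring
    simp_rw [h]
    rw [sum_prod_apply, ← mul_prod_erase univ _ (mem_univ i),
      ← mul_prod_erase (univ.erase i) _ (mem_erase.2 ⟨hij.symm, mem_univ j⟩),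
      prod_congr rfl (g := fun _ => ∑ a, w a)]
    · simp only [hij.symm, if_true, if_false, prod_const, card_erase_of_mem (mem_erase.2
        ⟨hij.symm, mem_univ j⟩), card_erase_of_mem (mem_univ i), card_univ, Nat.sub_sub,
        mul_ite, mul_one, mul_zero, sum_ite_eq', mem_univ, mul_assoc, ← mul_sum]
    · intro l hl
      have h1 := ne_of_mem_erase hl
      have h2 := ne_of_mem_erase (mem_of_mem_erase hl)
      simp [h1, h2]
  rw [sum_mul, ← sum_congr rfl fun a _ => key a, sum_comm]
  refine sum_congr rfl fun c _ => ?_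
  rw [← mul_sum]
  simp

/-- Mean of a one-letter function under a normalized product weight. -/
lemma mean_apply {w : α → ℝ} (hw : ∑ a, w a = 1) (F : α → ℝ) (i : ι) :
    ∑ c : ι → α, prodWeight w c * F (c i) = ∑ a, w a * F a := by
  simp [sum_prodWeight_mul_apply, hw]

lemma mean_sum {w : α → ℝ} (hw : ∑ a, w a = 1) (F : α → ℝ) :
    ∑ c : ι → α, prodWeight w c * ∑ i, F (c i) = Fintype.card ι * ∑ a, w a * F a := by
  simp_rw [mul_sum]
  rw [sum_comm]
  simp_rw [← mul_sum, mean_apply hw]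
  simp

/-- The variance of a sum of independent centred terms is the sum of the variances. -/
lemma mean_sum_sq {w : α → ℝ} (hw : ∑ a, w a = 1) {F : α → ℝ} (hF : ∑ a, w a * F a = 0) :
    ∑ c : ι → α, prodWeight w c * (∑ i, F (c i)) ^ 2
      = Fintype.card ι * ∑ a, w a * F a ^ 2 := by
  have h : ∀ c : ι → α, prodWeight w c * (∑ i, F (c i)) ^ 2
      = ∑ i, ∑ j, prodWeight w c * (F (c i) * F (c j)) := by
    intro c
    simp_rw [← mul_sum]
    rw [sq, sum_mul_sum]
    simp_rw [mul_sum]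
  simp_rw [h]
  rw [sum_comm]
  have h2 : ∀ i : ι, ∑ c : ι → α, ∑ j, prodWeight w c * (F (c i) * F (c j))
      = ∑ a, w a * F a ^ 2 := by
    intro i
    rw [sum_comm, sum_eq_single i]
    · rw [← mean_apply (ι := ι) hw (fun a => F a ^ 2) i]
      simp [sq]
    · intro j _ hj
      rw [sum_prodWeight_mul_apply_apply w (fun a b => F a * F b) hj.symm]
      have : ∑ a, ∑ b, w a * w b * (F a * F b) = (∑ a, w a * F a) * ∑ b, w b * F b := by
        rw [sum_mul_sum]
        exact sum_congr rfl fun a _ => sum_congr rfl fun b _ => by ring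
      rw [this, hF]; simp
    · simp
  simp [h2]

/-- Chernoff bound for a sum of independent identically distributed terms. -/
lemma chernoff {w : α → ℝ} (hw0 : ∀ a, 0 ≤ w a) (V : α → ℝ) {lam T x : ℝ} (hl : 0 ≤ lam)
    (hx : ∑ a, w a * Real.exp (lam * V a) ≤ 1 + x) :
    ∑ c : ι → α, prodWeight w c * (if T < ∑ i, V (c i) then 1 else 0)
      ≤ Real.exp (Fintype.card ι * x - lam * T) := by
  have h1 : ∑ c : ι → α, prodWeight w c * (if T < ∑ i, V (c i) then 1 else 0)
      ≤ ∑ c : ι → α, prodWeight w c * Real.exp (lam * ((∑ i, V (c i)) - T)) := by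
    refine sum_le_sum fun c _ => mul_le_mul_of_nonneg_left ?_ (prodWeight_nonneg hw0 c)
    split_ifs with h
    · exact Real.one_le_exp (mul_nonneg hl (by linarith))
    · positivity
  refine h1.trans ?_
  have h2 : ∀ c : ι → α, prodWeight w c * Real.exp (lam * ((∑ i, V (c i)) - T))
      = Real.exp (-(lam * T)) * prodWeight (fun a => w a * Real.exp (lam * V a)) c := by
    intro c
    rw [prodWeight, prodWeight, prod_mul_distrib, ← Real.exp_sum, ← mul_sum, mul_sub, sub_eq_add_neg,
      Real.exp_add]
    ring
  simp_rw [h2]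
  rw [← mul_sum, sum_prodWeight, sub_eq_add_neg, Real.exp_add, mul_comm]
  gcongr
  rw [mul_comm, Real.exp_mul]
  rw [Real.rpow_natCast]
  refine pow_le_pow_left₀ (sum_nonneg fun a _ => mul_nonneg (hw0 a) (Real.exp_pos _).le) ?_ _
  linarith [Real.add_one_le_exp x]

/-- Some outcome is at most the mean. -/
lemma exists_le_mean {w : α → ℝ} (hw0 : ∀ a, 0 ≤ w a) (hw : ∑ a, w a = 1) (F : α → ℝ) :
    ∃ a, F a ≤ ∑ b, w b * F b := by
  by_contra! h
  have h1 : ∑ a, w a * (∑ b, w b * F b) < ∑ a, w a * F a := by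
    obtain ⟨a, ha⟩ : ∃ a, 0 < w a := by
      by_contra! h0
      have := sum_nonpos (s := univ) fun a _ => h0 a
      linarith
    exact sum_lt_sum (fun b _ => mul_le_mul_of_nonneg_left (h b).le (hw0 b))
      ⟨a, mem_univ a, mul_lt_mul_of_pos_left (h a) ha⟩
  rw [← sum_mul, hw] at h1
  linarith

end ProductWeights

end CovertComm

namespace CovertComm

open Finset

section Confusion

lemma exp_le_one_add_two_mul {v : ℝ} (h0 : 0 ≤ v) (h1 : v ≤ 1) : Real.exp v ≤ 1 + 2 * v := by
  have := Real.abs_exp_sub_one_le (x := v) (by rwa [abs_of_nonneg h0])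
  rw [abs_of_nonneg h0] at this
  linarith [le_abs_self (Real.exp v - 1)]

lemma ite_one_zero_nonneg (P : Prop) [Decidable P] : (0 : ℝ) ≤ if P then 1 else 0 := by
  split_ifs <;> simp

open scoped Classical in
/-- Total weight of the messages in the codebook `c` that are missed or confused with another
message. -/
noncomputable def badWeight {α : Type*} {N : ℕ} (W : α → ℝ) (miss : α → Prop)
    (conf : α → α → Prop) (c : Fin N → α) : ℝ :=
  ∑ m, W (c m) * (if miss (c m) ∨ ∃ m', m' ≠ m ∧ conf (c m) (c m') then 1 else 0)

variable {α : Type*} [Fintype α]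

open scoped Classical in
lemma mean_exp_badWeight_le {N : ℕ} {w W : α → ℝ} (hw0 : ∀ a, 0 ≤ w a) (hw : ∑ a, w a = 1)
    (hW : ∀ a, 0 ≤ W a) (miss : α → Prop) (conf : α → α → Prop) {lam w₀ d₁ d₂ : ℝ}
    (hl : 0 ≤ lam) (hlW : ∀ a, lam * W a ≤ 1) (hw₀ : ∑ a, w a * W a ≤ w₀)
    (hlN : lam * N * w₀ ≤ 1)
    (hd₁ : ∑ a, w a * (W a * (if miss a then 1 else 0)) ≤ d₁)
    (hd₂ : ∑ a, ∑ b, w a * w b * (W a * (if conf a b then 1 else 0)) ≤ d₂) :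
    ∑ c : Fin N → α, prodWeight w c * Real.exp (lam * badWeight W miss conf c)
      ≤ 1 + Real.exp 4 * (lam * N * (d₁ + N * d₂)) := by
  set w' : α → ℝ := fun a => w a * Real.exp (lam * W a) with hw'
  have hw'0 : ∀ a, 0 ≤ w' a := fun a => mul_nonneg (hw0 a) (Real.exp_pos _).le
  have hw'e : ∀ a, w' a ≤ Real.exp 1 * w a := fun a => by
    rw [mul_comm (Real.exp 1)]
    exact mul_le_mul_of_nonneg_left (Real.exp_le_exp.2 (hlW a)) (hw0 a)
  set S := ∑ a, w' a with hS
  have hS0 : 0 ≤ S := sum_nonneg fun a _ => hw'0 a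
  have hw₀0 : 0 ≤ w₀ := (sum_nonneg fun a _ => mul_nonneg (hw0 a) (hW a)).trans hw₀
  have hSle : S ≤ Real.exp (2 * (lam * w₀)) := by
    have : S ≤ ∑ a, (w a + 2 * lam * (w a * W a)) := by
      refine sum_le_sum fun a _ => ?_
      have := exp_le_one_add_two_mul (mul_nonneg hl (hW a)) (hlW a)
      calc w a * Real.exp (lam * W a) ≤ w a * (1 + 2 * (lam * W a)) :=
            mul_le_mul_of_nonneg_left this (hw0 a)
        _ = _ := by ring
    rw [sum_add_distrib, ← mul_sum, hw] at this
    refine this.trans (le_trans ?_ (Real.add_one_le_exp _))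
    have := mul_le_mul_of_nonneg_left hw₀ (by positivity : 0 ≤ 2 * lam)
    linarith
  have hSpow : ∀ k ≤ N, S ^ k ≤ Real.exp 2 := by
    intro k hk
    refine (pow_le_pow_left₀ hS0 hSle k).trans ?_
    rw [← Real.exp_nat_mul]
    apply Real.exp_le_exp.2
    have : (k : ℝ) ≤ N := by exact_mod_cast hk
    have := mul_le_mul_of_nonneg_right this (mul_nonneg hl hw₀0)
    nlinarith
  have hpt : ∀ c : Fin N → α, prodWeight w c * Real.exp (lam * badWeight W miss conf c)
      ≤ prodWeight w c + lam * ∑ m, (prodWeight w' c * (W (c m) * (if miss (c m) then 1 else 0))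
        + ∑ m' ∈ univ.erase m, prodWeight w' c * (W (c m) * (if conf (c m) (c m') then 1 else 0))) := by
    intro c
    have hVU : badWeight W miss conf c ≤ ∑ m, W (c m) := by
      refine sum_le_sum fun m _ => ?_
      split_ifs <;> simp [hW]
    have hV0 : 0 ≤ badWeight W miss conf c :=
      sum_nonneg fun m _ => mul_nonneg (hW _) (ite_one_zero_nonneg _)
    have hV : badWeight W miss conf c ≤ ∑ m, (W (c m) * (if miss (c m) then 1 else 0)
        + ∑ m' ∈ univ.erase m, W (c m) * (if conf (c m) (c m') then 1 else 0)) := by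
      refine sum_le_sum fun m _ => ?_
      rw [← mul_sum, ← mul_add]
      refine mul_le_mul_of_nonneg_left ?_ (hW _)
      have hn : 0 ≤ ∑ m' ∈ univ.erase m, (if conf (c m) (c m') then (1 : ℝ) else 0) :=
        sum_nonneg fun _ _ => by split_ifs <;> simp
      split_ifs with h1 h2 h2
      · linarith
      · obtain ⟨m', hm', hc⟩ := h1.resolve_left h2
        have := single_le_sum (f := fun m' => if conf (c m) (c m') then (1 : ℝ) else 0)
          (fun i _ => by split_ifs <;> simp) (mem_erase.2 ⟨hm', mem_univ m'⟩)
        simp only [hc, if_true] at this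
        linarith
      · linarith
      · linarith
    have hpw : prodWeight w' c = prodWeight w c * Real.exp (lam * ∑ m, W (c m)) := by
      rw [prodWeight, prodWeight, prod_mul_distrib, ← Real.exp_sum, mul_sum]
    have hexp : Real.exp (lam * badWeight W miss conf c)
        ≤ 1 + lam * badWeight W miss conf c * Real.exp (lam * ∑ m, W (c m)) := by
      set v := lam * badWeight W miss conf c
      have hv : 0 ≤ v := mul_nonneg hl hV0
      have h1 : Real.exp v ≤ 1 + v * Real.exp v := by
        have := Real.add_one_le_exp (-v)
        have h2 := mul_le_mul_of_nonneg_right this (Real.exp_pos v).le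
        rw [← Real.exp_add, neg_add_cancel, Real.exp_zero] at h2
        linarith
      refine h1.trans ?_
      gcongr
      exact mul_le_mul_of_nonneg_left hVU hl
    calc _ ≤ prodWeight w c * (1 + lam * badWeight W miss conf c
          * Real.exp (lam * ∑ m, W (c m))) :=
          mul_le_mul_of_nonneg_left hexp (prodWeight_nonneg hw0 c)
      _ = prodWeight w c + lam * (prodWeight w' c * badWeight W miss conf c) := by rw [hpw]; ring
      _ ≤ _ := by
          have := mul_le_mul_of_nonneg_left hV (prodWeight_nonneg hw'0 c)
          rw [mul_sum] at this
          simp_rw [mul_add, mul_sum] at this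
          gcongr
  refine (sum_le_sum fun c _ => hpt c).trans ?_
  rw [sum_add_distrib, sum_prodWeight, hw, one_pow, ← mul_sum, sum_comm]
  gcongr 1 + ?_
  have hm : ∀ m : Fin N, ∑ c : Fin N → α, (prodWeight w' c * (W (c m) * (if miss (c m) then 1 else 0))
        + ∑ m' ∈ univ.erase m, prodWeight w' c * (W (c m) * (if conf (c m) (c m') then 1 else 0)))
      ≤ Real.exp 4 * (d₁ + N * d₂) := by
    intro m
    have hd₁0 : 0 ≤ d₁ := (sum_nonneg fun a _ => mul_nonneg (hw0 a) (mul_nonneg (hW a)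
      (ite_one_zero_nonneg _))).trans hd₁
    have hd₂0 : 0 ≤ d₂ := (sum_nonneg fun a _ => sum_nonneg fun b _ => mul_nonneg
      (mul_nonneg (hw0 a) (hw0 b)) (mul_nonneg (hW a) (ite_one_zero_nonneg _))).trans hd₂
    rw [sum_add_distrib, sum_prodWeight_mul_apply w'
      (fun a => W a * (if miss a then 1 else 0)), sum_comm]
    have h1 : ∑ a, w' a * (W a * (if miss a then 1 else 0)) ≤ Real.exp 1 * d₁ := by
      refine le_trans ?_ (mul_le_mul_of_nonneg_left hd₁ (Real.exp_pos 1).le)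
      rw [mul_sum]
      refine sum_le_sum fun a _ => ?_
      rw [← mul_assoc (Real.exp 1)]
      exact mul_le_mul_of_nonneg_right (hw'e a) (mul_nonneg (hW a) (ite_one_zero_nonneg (miss a)))
    have h2 : ∑ a, ∑ b, w' a * w' b * (W a * (if conf a b then 1 else 0)) ≤ Real.exp 2 * d₂ := by
      refine le_trans ?_ (mul_le_mul_of_nonneg_left hd₂ (Real.exp_pos 2).le)
      simp_rw [mul_sum]
      refine sum_le_sum fun a _ => sum_le_sum fun b _ => ?_
      rw [← mul_assoc (Real.exp 2)]
      refine mul_le_mul_of_nonneg_right ?_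
        (mul_nonneg (hW a) (ite_one_zero_nonneg (conf a b)))
      refine (mul_le_mul (hw'e a) (hw'e b) (hw'0 b)
        (mul_nonneg (Real.exp_pos 1).le (hw0 a))).trans (le_of_eq ?_)
      rw [show (2 : ℝ) = 1 + 1 by norm_num, Real.exp_add]; ring
    have h3 : ∀ m' ∈ univ.erase m, ∑ c : Fin N → α,
        prodWeight w' c * (W (c m) * (if conf (c m) (c m') then 1 else 0)) ≤ Real.exp 4 * d₂ := by
      intro m' hm'
      rw [sum_prodWeight_mul_apply_apply w' (fun a b => W a * (if conf a b then 1 else 0))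
        (ne_of_mem_erase hm').symm]
      refine (mul_le_mul h2 (hSpow _ (by simp)) (pow_nonneg hS0 _)
        (mul_nonneg (Real.exp_pos 2).le hd₂0)).trans (le_of_eq ?_)
      rw [show (4 : ℝ) = 2 + 2 by norm_num, Real.exp_add]; ring
    have h4 : (∑ a, w' a * (W a * (if miss a then 1 else 0))) * S ^ (Fintype.card (Fin N) - 1)
        ≤ Real.exp 4 * d₁ := by
      refine (mul_le_mul h1 (hSpow _ (by simp)) (pow_nonneg hS0 _)
        (mul_nonneg (Real.exp_pos 1).le hd₁0)).trans ?_
      have : Real.exp 1 * Real.exp 2 ≤ Real.exp 4 := by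
        rw [← Real.exp_add]; exact Real.exp_le_exp.2 (by norm_num)
      nlinarith
    have h5 := sum_le_sum h3
    rw [sum_const, nsmul_eq_mul] at h5
    have h6 : ((univ.erase m).card : ℝ) ≤ N := by
      exact_mod_cast (card_le_univ _).trans (by simp)
    have h7 := mul_le_mul_of_nonneg_right h6 (mul_nonneg (Real.exp_pos 4).le hd₂0)
    linarith
  calc lam * _ ≤ lam * ∑ m : Fin N, Real.exp 4 * (d₁ + N * d₂) :=
        mul_le_mul_of_nonneg_left (sum_le_sum fun m _ => hm m) hl
    _ = _ := by simp; ring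

end Confusion

end CovertComm

namespace CovertComm

open Finset

/-- The Bernoulli weight of a bit. -/
def ber (q : ℝ) (b : Bool) : ℝ := if b then q else 1 - q

/-- The likelihood ratio `P(Z = b | X = 1) / P(Z = b | X = 0)` of James' channel. -/
noncomputable def lr (q : ℝ) (b : Bool) : ℝ := if b then (1 - q) / q else q / (1 - q)

/-- The probability that Bob sees a one where Alice sent a one under the worst-case jamming. -/
noncomputable def theta (p q : ℝ) : ℝ := 1 - (1 - q) * p / q

/-- The likelihood ratio `P(Y = b | X = 1) / P(Y = b | X = 0)` under the worst-case jamming. -/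
noncomputable def dlr (p q : ℝ) (b : Bool) : ℝ :=
  if b then theta p q / p else (1 - theta p q) / (1 - p)

variable {n : ℕ}

/-- The sum of the coefficients `c` over the support of `x`. -/
def lin (c : Fin n → ℝ) (x : BV n) : ℝ := ∑ i, if x i then c i else 0

/-- James' log-likelihood ratio of the codeword `x` given the observation `z`. -/
noncomputable def jamesLL (q : ℝ) (z x : BV n) : ℝ := lin (fun i => Real.log (lr q (z i))) x

/-- Bob's decoding score of the codeword `x` given the received word `y`. -/
noncomputable def score (p q : ℝ) (x y : BV n) : ℝ := lin (fun i => Real.log (dlr p q (y i))) x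

lemma noiseP_eq_prodWeight (q : ℝ) : (noiseP q : BV n → ℝ) = prodWeight (ber q) := rfl

lemma sum_ber (q : ℝ) : ∑ b, ber q b = 1 := by simp [ber]

lemma ber_nonneg {q : ℝ} (h0 : 0 ≤ q) (h1 : q ≤ 1) (b : Bool) : 0 ≤ ber q b := by
  unfold ber; split_ifs <;> linarith

lemma noiseP_nonneg {q : ℝ} (h0 : 0 ≤ q) (h1 : q ≤ 1) (z : BV n) : 0 ≤ noiseP q z :=
  prodWeight_nonneg (ber_nonneg h0 h1) z

lemma sum_noiseP (q : ℝ) : ∑ z : BV n, noiseP q z = 1 := by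
  rw [noiseP_eq_prodWeight, sum_prodWeight, sum_ber, one_pow]

lemma lr_pos {q : ℝ} (h0 : 0 < q) (h1 : q < 1) (b : Bool) : 0 < lr q b := by
  have : 0 < 1 - q := by linarith
  unfold lr; split_ifs <;> positivity

lemma sum_ber_mul_lr {q : ℝ} (h0 : 0 < q) (h1 : q < 1) : ∑ b, ber q b * lr q b = 1 := by
  have : 1 - q ≠ 0 := by linarith
  simp [ber, lr]; field_simp; ring

lemma exp_lin (c : Fin n → ℝ) (x : BV n) :
    Real.exp (lin c x) = ∏ i, if x i then Real.exp (c i) else 1 := by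
  rw [lin, Real.exp_sum]
  refine prod_congr rfl fun i _ => ?_
  split_ifs <;> simp

lemma noiseP_vxor {q : ℝ} (h0 : 0 < q) (h1 : q < 1) (z x : BV n) :
    noiseP q (vxor z x) = noiseP q z * Real.exp (jamesLL q z x) := by
  have h2 : 1 - q ≠ 0 := by linarith
  rw [jamesLL, exp_lin, noiseP, noiseP, ← prod_mul_distrib]
  refine prod_congr rfl fun i _ => ?_
  rw [Real.exp_log (lr_pos h0 h1 _)]
  cases hz : z i <;> cases hx : x i <;> simp [vxor, lr, hz, hx] <;> field_simp

lemma mean_exp_lin (ρ : ℝ) (c : Fin n → ℝ) :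
    ∑ x : BV n, noiseP ρ x * Real.exp (lin c x) = ∏ i, (1 - ρ + ρ * Real.exp (c i)) := by
  have h : ∀ x : BV n, noiseP ρ x * Real.exp (lin c x)
      = ∏ i, (fun b : Bool => if b then ρ * Real.exp (c i) else 1 - ρ) (x i) := by
    intro x
    rw [exp_lin, noiseP, ← prod_mul_distrib]
    refine prod_congr rfl fun i _ => ?_
    cases hx : x i <;> simp
  simp_rw [h]
  rw [sum_prod_apply (fun i (b : Bool) => if b then ρ * Real.exp (c i) else 1 - ρ)]
  refine prod_congr rfl fun i _ => ?_
  simp [add_comm]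

lemma mean_exp_lin_le {ρ : ℝ} (h0 : 0 ≤ ρ) (h1 : ρ ≤ 1) (c : Fin n → ℝ) :
    ∑ x : BV n, noiseP ρ x * Real.exp (lin c x) ≤ Real.exp (ρ * (∑ i, Real.exp (c i) - n)) := by
  rw [mean_exp_lin]
  have : ρ * (∑ i, Real.exp (c i) - n) = ∑ i, ρ * (Real.exp (c i) - 1) := by
    rw [← mul_sum, sum_sub_distrib]; simp
  rw [this, Real.exp_sum]
  refine prod_le_prod (fun i _ => ?_) fun i _ => ?_
  · have := mul_nonneg h0 (Real.exp_pos (c i)).le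
    linarith
  · linarith [Real.add_one_le_exp (ρ * (Real.exp (c i) - 1))]

lemma lin_add (c d : Fin n → ℝ) (x : BV n) : lin c x + lin d x = lin (fun i => c i + d i) x := by
  rw [lin, lin, lin, ← sum_add_distrib]
  exact sum_congr rfl fun i _ => by split_ifs <;> simp

lemma mul_lin (r : ℝ) (c : Fin n → ℝ) (x : BV n) : r * lin c x = lin (fun i => r * c i) x := by
  rw [lin, lin, mul_sum]
  exact sum_congr rfl fun i _ => by split_ifs <;> simp

lemma sum_bool_eq (f : Bool → ℝ) (s : BV n) :
    ∑ i, f (s i) = n * f false + wt s * (f true - f false) := by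
  have h : ∀ i, f (s i) = f false + if s i = true then f true - f false else 0 := by
    intro i; cases s i <;> simp
  simp_rw [h]
  rw [sum_add_distrib, ← sum_filter]
  simp [wt, mul_sub]

open scoped Classical in
lemma indicator_lt_le_exp {a b κ : ℝ} (hκ : 0 ≤ κ) :
    (if a < b then (1 : ℝ) else 0) ≤ Real.exp (κ * (b - a)) := by
  split_ifs with h
  · exact Real.one_le_exp (mul_nonneg hκ (by linarith))
  · exact (Real.exp_pos _).le

open scoped Classical in
lemma indicator_le_le_exp {a b : ℝ} :
    (if a ≤ b then (1 : ℝ) else 0) ≤ Real.exp (b - a) := by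
  split_ifs with h
  · exact Real.one_le_exp (by linarith)
  · exact (Real.exp_pos _).le

section Parameters

variable {p q ρ : ℝ}

lemma mean_jamesLL (hq0 : 0 < q) (hq1 : q < 1) (z : BV n) :
    ∑ x : BV n, noiseP ρ x * Real.exp (jamesLL q z x) = ∏ i, (1 - ρ + ρ * lr q (z i)) := by
  simp_rw [jamesLL, mean_exp_lin]
  exact prod_congr rfl fun i _ => by rw [Real.exp_log (lr_pos hq0 hq1 _)]

lemma mean_jamesLL_le (hq0 : 0 < q) (hq1 : q < 1) (h0 : 0 ≤ ρ) (h1 : ρ ≤ 1) {η : ℝ} {z : BV n}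
    (hz : ∑ i, lr q (z i) ≤ (1 + η) * n) :
    ∑ x : BV n, noiseP ρ x * Real.exp (jamesLL q z x) ≤ Real.exp (n * ρ * η) := by
  refine (mean_exp_lin_le h0 h1 _).trans (Real.exp_le_exp.2 ?_)
  simp_rw [Real.exp_log (lr_pos hq0 hq1 _)]
  have := mul_le_mul_of_nonneg_left hz h0
  linarith

lemma theta_bounds (hp0 : 0 < p) (hpq : p < q) (hq1 : q < 1) :
    p < theta p q ∧ theta p q < 1 := by
  have hq0 : 0 < q := hp0.trans hpq
  have h : theta p q = ((q - p) + p * q) / q := by rw [theta]; field_simp; ring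
  constructor
  · rw [h, lt_div_iff₀ hq0]; linarith
  · have : 0 < (1 - q) * p / q := by
      have : 0 < 1 - q := by linarith
      positivity
    rw [theta]; linarith

lemma dlr_pos (hp0 : 0 < p) (hpq : p < q) (hq1 : q < 1) (b : Bool) : 0 < dlr p q b := by
  obtain ⟨h1, h2⟩ := theta_bounds hp0 hpq hq1
  unfold dlr
  split_ifs
  · exact div_pos (by linarith) hp0
  · exact div_pos (by linarith) (by linarith)

lemma dlr_false_lt_one (hp0 : 0 < p) (hpq : p < q) (hq1 : q < 1) : dlr p q false < 1 := by
  obtain ⟨h1, h2⟩ := theta_bounds hp0 hpq hq1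
  simp only [dlr, Bool.false_eq_true, if_false]
  rw [div_lt_one (by linarith)]; linarith

lemma one_lt_dlr_true (hp0 : 0 < p) (hpq : p < q) (hq1 : q < 1) : 1 < dlr p q true := by
  obtain ⟨h1, h2⟩ := theta_bounds hp0 hpq hq1
  simp only [dlr, if_true]
  rwa [one_lt_div hp0]

lemma sum_dlr_le (hp0 : 0 < p) (hpq : p < q) (hq1 : q < 1) {s : BV n} (hs : (wt s : ℝ) ≤ p * n) :
    ∑ i, dlr p q (s i) ≤ n := by
  rw [sum_bool_eq]
  have h1 := dlr_false_lt_one hp0 hpq hq1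
  have h2 := one_lt_dlr_true hp0 hpq hq1
  have h3 := mul_le_mul_of_nonneg_right hs (by linarith : 0 ≤ dlr p q true - dlr p q false)
  have h4 : (1 - p) * dlr p q false + p * dlr p q true = 1 := by
    have : 1 - p ≠ 0 := by linarith
    simp [dlr]; field_simp; ring
  nlinarith

open scoped Classical in
/-- The mean weight of codewords scoring below the threshold after jamming by `s`. -/
lemma mean_miss_le (hp0 : 0 < p) (hpq : p < q) (hq2 : q < 1 / 2) (h0 : 0 ≤ ρ) (h1 : ρ ≤ 1)
    {η κ thr : ℝ} (hη : 0 ≤ η) (hκ : 0 ≤ κ) {z s : BV n}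
    (hz : ∑ i, lr q (z i) ≤ (1 + η) * n) (hs : (wt s : ℝ) ≤ p * n) :
    ∑ x : BV n, noiseP ρ x * (Real.exp (jamesLL q z x)
        * (if score p q x (vxor x s) < thr then 1 else 0))
      ≤ Real.exp (n * ρ * (theta p q * Real.exp (-(κ * Real.log (dlr p q true)))
          + (1 - theta p q) * Real.exp (-(κ * Real.log (dlr p q false))) - 1 + η) + κ * thr) := by
  have hq0 : 0 < q := hp0.trans hpq
  have hq1 : q < 1 := by linarith
  have hsc : ∀ x : BV n, score p q x (vxor x s)
      = lin (fun i => Real.log (dlr p q (!s i))) x := by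
    intro x
    rw [score, lin, lin]
    refine sum_congr rfl fun i _ => ?_
    cases hx : x i <;> simp [vxor, hx]
  set E1 := Real.exp (-(κ * Real.log (dlr p q true))) with hE1
  set E0 := Real.exp (-(κ * Real.log (dlr p q false))) with hE0
  have hE1le : E1 ≤ 1 := by
    rw [hE1, Real.exp_le_one_iff, neg_nonpos]
    exact mul_nonneg hκ (Real.log_nonneg (one_lt_dlr_true hp0 hpq hq1).le)
  have hE0ge : 1 ≤ E0 := by
    rw [hE0]
    apply Real.one_le_exp
    rw [neg_nonneg]
    exact mul_nonpos_of_nonneg_of_nonpos hκ (Real.log_nonpos (dlr_pos hp0 hpq hq1 _).le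
      (dlr_false_lt_one hp0 hpq hq1).le)
  have hE1pos : 0 < E1 := Real.exp_pos _
  have hpt : ∀ x : BV n, noiseP ρ x * (Real.exp (jamesLL q z x)
        * (if score p q x (vxor x s) < thr then 1 else 0))
      ≤ Real.exp (κ * thr) * (noiseP ρ x * Real.exp (lin (fun i => Real.log (lr q (z i))
          + -κ * Real.log (dlr p q (!s i))) x)) := by
    intro x
    rw [← lin_add, ← mul_lin, ← hsc, mul_left_comm (Real.exp (κ * thr))]
    refine mul_le_mul_of_nonneg_left ?_ (noiseP_nonneg h0 h1 x)
    refine (mul_le_mul_of_nonneg_left (indicator_lt_le_exp hκ) (Real.exp_pos _).le).trans ?_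
    rw [← Real.exp_add, ← Real.exp_add, jamesLL]
    exact Real.exp_le_exp.2 (by linarith)
  refine (sum_le_sum fun x _ => hpt x).trans ?_
  rw [← mul_sum]
  refine (mul_le_mul_of_nonneg_left (mean_exp_lin_le h0 h1 _) (Real.exp_pos _).le).trans ?_
  rw [← Real.exp_add]
  apply Real.exp_le_exp.2
  have hterm : ∀ i, Real.exp (Real.log (lr q (z i)) + -κ * Real.log (dlr p q (!s i)))
      ≤ lr q (z i) * E1 + (E0 - E1) * (if s i then (1 - q) / q else 0) := by
    intro i
    rw [Real.exp_add, Real.exp_log (lr_pos hq0 hq1 _)]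
    cases hsi : s i
    · simp [hE1]
    · simp only [Bool.not_true, if_true, neg_mul, ← hE0]
      have h2 : lr q (z i) ≤ (1 - q) / q := by
        unfold lr
        split_ifs
        · exact le_rfl
        · rw [div_le_div_iff₀ (by linarith) hq0]; nlinarith
      nlinarith
  have hsum := sum_le_sum (s := univ) fun i (_ : i ∈ univ) => hterm i
  rw [sum_add_distrib, ← sum_mul, ← mul_sum, ← sum_filter, sum_const, nsmul_eq_mul] at hsum
  have hcard : ((univ.filter fun i => s i = true).card : ℝ) * ((1 - q) / q)
      ≤ (1 - theta p q) * n := by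
    have : (wt s : ℝ) * ((1 - q) / q) ≤ p * n * ((1 - q) / q) :=
      mul_le_mul_of_nonneg_right hs (div_nonneg (by linarith) hq0.le)
    refine this.trans (le_of_eq ?_)
    rw [theta]; ring
  have hA := mul_le_mul_of_nonneg_right hz hE1pos.le
  have hB := mul_le_mul_of_nonneg_left hcard (by linarith : 0 ≤ E0 - E1)
  have hn : (0 : ℝ) ≤ n := Nat.cast_nonneg n
  have hηE : η * n * E1 ≤ η * n := mul_le_of_le_one_right (by positivity) hE1le
  have hfin : ∑ i, Real.exp (Real.log (lr q (z i)) + -κ * Real.log (dlr p q (!s i))) - n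
      ≤ n * (theta p q * E1 + (1 - theta p q) * E0 - 1 + η) := by
    nlinarith
  have := mul_le_mul_of_nonneg_left hfin h0
  linarith

open scoped Classical in
/-- The mean weight of confusable pairs of codewords after jamming by `s`. -/
lemma mean_conf_le (hp0 : 0 < p) (hpq : p < q) (hq2 : q < 1 / 2) (h0 : 0 ≤ ρ) (h1 : ρ ≤ 1)
    {η thr : ℝ} {z s : BV n}
    (hz : ∑ i, lr q (z i) ≤ (1 + η) * n) (hs : (wt s : ℝ) ≤ p * n) :
    ∑ x : BV n, ∑ x' : BV n, noiseP ρ x * noiseP ρ x' * (Real.exp (jamesLL q z x)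
        * (if thr ≤ score p q x' (vxor x s) then 1 else 0))
      ≤ Real.exp (n * ρ * ((1 + η) * Real.exp (ρ * dlr p q true) - 1) - thr) := by
  have hq0 : 0 < q := hp0.trans hpq
  have hq1 : q < 1 := by linarith
  have hin : ∀ x : BV n, ∑ x' : BV n, noiseP ρ x * noiseP ρ x' * (Real.exp (jamesLL q z x)
        * (if thr ≤ score p q x' (vxor x s) then 1 else 0))
      ≤ Real.exp (-thr) * (noiseP ρ x * Real.exp (lin (fun i => Real.log (lr q (z i))
          + ρ * dlr p q true) x)) := by
    intro x
    have hy : ∑ i, dlr p q (vxor x s i) ≤ n + lin (fun _ => dlr p q true) x := by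
      refine le_trans ?_ (add_le_add_left (sum_dlr_le hp0 hpq hq1 hs) _)
      rw [lin, ← sum_add_distrib]
      refine sum_le_sum fun i _ => ?_
      have h3 := dlr_pos hp0 hpq hq1 true
      have h4 := dlr_pos hp0 hpq hq1 false
      have h5 := dlr_false_lt_one hp0 hpq hq1
      have h6 := one_lt_dlr_true hp0 hpq hq1
      cases hx : x i <;> cases hsi : s i <;> simp [vxor, hx, hsi] <;> linarith
    have hx' : ∑ x' : BV n, noiseP ρ x' * (if thr ≤ score p q x' (vxor x s) then (1 : ℝ) else 0)
        ≤ Real.exp (-thr) * Real.exp (ρ * lin (fun _ => dlr p q true) x) := by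
      have hpt : ∀ x' : BV n,
          noiseP ρ x' * (if thr ≤ score p q x' (vxor x s) then (1 : ℝ) else 0)
          ≤ Real.exp (-thr) * (noiseP ρ x' * Real.exp (score p q x' (vxor x s))) := by
        intro x'
        rw [mul_left_comm, ← Real.exp_add, neg_add_eq_sub]
        exact mul_le_mul_of_nonneg_left indicator_le_le_exp (noiseP_nonneg h0 h1 x')
      refine (sum_le_sum fun x' _ => hpt x').trans ?_
      rw [← mul_sum]
      refine mul_le_mul_of_nonneg_left ((mean_exp_lin_le h0 h1 _).trans
        (Real.exp_le_exp.2 (mul_le_mul_of_nonneg_left ?_ h0))) (Real.exp_pos _).le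
      simp_rw [Real.exp_log (dlr_pos hp0 hpq hq1 _)]
      linarith
    rw [← lin_add, Real.exp_add, ← mul_lin]
    calc _ = noiseP ρ x * Real.exp (jamesLL q z x) * ∑ x' : BV n, noiseP ρ x'
            * (if thr ≤ score p q x' (vxor x s) then (1 : ℝ) else 0) := by
          rw [mul_sum]; exact sum_congr rfl fun _ _ => by ring
      _ ≤ noiseP ρ x * Real.exp (jamesLL q z x) * (Real.exp (-thr)
            * Real.exp (ρ * lin (fun _ => dlr p q true) x)) :=
          mul_le_mul_of_nonneg_left hx' (mul_nonneg (noiseP_nonneg h0 h1 x) (Real.exp_pos _).le)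
      _ = _ := by rw [jamesLL]; ring
  refine (sum_le_sum fun x _ => hin x).trans ?_
  rw [← mul_sum]
  refine (mul_le_mul_of_nonneg_left (mean_exp_lin_le h0 h1 _) (Real.exp_pos _).le).trans ?_
  rw [← Real.exp_add]
  apply Real.exp_le_exp.2
  simp_rw [Real.exp_add, Real.exp_log (lr_pos hq0 hq1 _)]
  rw [← sum_mul]
  have h3 := mul_le_mul_of_nonneg_right hz (Real.exp_pos (ρ * dlr p q true)).le
  have h4 := mul_le_mul_of_nonneg_left h3 h0
  linarith

open scoped Classical in
lemma mean_false_alarm_le (hp0 : 0 < p) (hpq : p < q) (hq1 : q < 1) (h0 : 0 ≤ ρ) (h1 : ρ ≤ 1)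
    {thr : ℝ} {s : BV n} (hs : (wt s : ℝ) ≤ p * n) :
    ∑ x : BV n, noiseP ρ x * (if thr ≤ score p q x s then 1 else 0) ≤ Real.exp (-thr) := by
  have hpt : ∀ x : BV n, noiseP ρ x * (if thr ≤ score p q x s then (1 : ℝ) else 0)
      ≤ Real.exp (-thr) * (noiseP ρ x * Real.exp (score p q x s)) := by
    intro x
    rw [mul_left_comm, ← Real.exp_add, neg_add_eq_sub]
    exact mul_le_mul_of_nonneg_left indicator_le_le_exp (noiseP_nonneg h0 h1 x)
  refine (sum_le_sum fun x _ => hpt x).trans ?_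
  rw [← mul_sum]
  refine mul_le_of_le_one_right (Real.exp_pos _).le ((mean_exp_lin_le h0 h1 _).trans ?_)
  rw [Real.exp_le_one_iff]
  refine mul_nonpos_of_nonneg_of_nonpos h0 ?_
  simp_rw [Real.exp_log (dlr_pos hp0 hpq hq1 _)]
  linarith [sum_dlr_le hp0 hpq hq1 hs]

open scoped Classical in
/-- Atypically large likelihood ratios are unlikely under the joint distribution. -/
lemma mean_large_jamesLL_le (hq0 : 0 < q) (hq1 : q < 1) (h0 : 0 ≤ ρ) (h1 : ρ ≤ 1)
    {κ b : ℝ} (hκ : 0 ≤ κ) :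
    ∑ z : BV n, noiseP q z * ∑ x : BV n, noiseP ρ x * (Real.exp (jamesLL q z x)
        * (if b < jamesLL q z x then 1 else 0))
      ≤ Real.exp (n * ρ * (∑ a, ber q a * Real.exp ((1 + κ) * Real.log (lr q a)) - 1) - κ * b) := by
  have hin : ∀ z : BV n, ∑ x : BV n, noiseP ρ x * (Real.exp (jamesLL q z x)
        * (if b < jamesLL q z x then 1 else 0))
      ≤ Real.exp (-(κ * b)) * ∏ i, (1 - ρ + ρ * Real.exp ((1 + κ) * Real.log (lr q (z i)))) := by
    intro z
    rw [← mean_exp_lin, mul_sum]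
    refine sum_le_sum fun x _ => ?_
    rw [mul_left_comm (Real.exp (-(κ * b))), ← mul_lin]
    refine mul_le_mul_of_nonneg_left ?_ (noiseP_nonneg h0 h1 x)
    refine (mul_le_mul_of_nonneg_left (indicator_lt_le_exp hκ) (Real.exp_pos _).le).trans ?_
    rw [← Real.exp_add, ← Real.exp_add, jamesLL]
    exact Real.exp_le_exp.2 (by linarith)
  refine (sum_le_sum fun z _ => mul_le_mul_of_nonneg_left (hin z)
    (noiseP_nonneg hq0.le hq1.le z)).trans ?_
  have heq : ∀ z : BV n, noiseP q z * (Real.exp (-(κ * b))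
        * ∏ i, (1 - ρ + ρ * Real.exp ((1 + κ) * Real.log (lr q (z i)))))
      = Real.exp (-(κ * b)) * prodWeight (fun a => ber q a
        * (1 - ρ + ρ * Real.exp ((1 + κ) * Real.log (lr q a)))) z := by
    intro z
    rw [mul_left_comm, noiseP_eq_prodWeight, prodWeight, prodWeight, prod_mul_distrib]
  simp_rw [heq]
  rw [← mul_sum, sum_prodWeight, sub_eq_add_neg (n * ρ * _), Real.exp_add, mul_comm,
    mul_assoc (n : ℝ), Real.exp_nat_mul, Fintype.card_fin]
  refine mul_le_mul_of_nonneg_right (pow_le_pow_left₀ (sum_nonneg fun a _ => ?_) ?_ _)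
    (Real.exp_pos _).le
  · exact mul_nonneg (ber_nonneg hq0.le hq1.le a)
      (add_nonneg (by linarith) (mul_nonneg h0 (Real.exp_pos _).le))
  · refine le_trans (le_of_eq ?_) (Real.add_one_le_exp _)
    simp_rw [mul_add, sum_add_distrib, ← sum_mul, sum_ber, mul_left_comm _ ρ, ← mul_sum]
    ring

open scoped Classical in
/-- Atypical observations are unlikely when Alice transmits. -/
lemma mean_atypical_le (hq0 : 0 < q) (hq2 : q < 1 / 2) (h0 : 0 ≤ ρ) (h1 : ρ ≤ 1)
    {κ η : ℝ} (hκ : 0 ≤ κ) :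
    ∑ z : BV n, noiseP q z * ∑ x : BV n, noiseP ρ x * (Real.exp (jamesLL q z x)
        * (if (1 + η) * n < ∑ i, lr q (z i) then 1 else 0))
      ≤ (∑ a, ber q a * Real.exp (κ * (lr q a - 1 - η))) ^ n
        * Real.exp (n * ρ * lr q true) := by
  have hq1 : q < 1 := by linarith
  have hin : ∀ z : BV n, noiseP q z * ∑ x : BV n, noiseP ρ x * (Real.exp (jamesLL q z x)
        * (if (1 + η) * n < ∑ i, lr q (z i) then 1 else 0))
      ≤ prodWeight (fun a => ber q a * Real.exp (κ * (lr q a - 1 - η))) z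
        * Real.exp (n * ρ * lr q true) := by
    intro z
    simp_rw [← mul_assoc (noiseP ρ _)]
    rw [← sum_mul, mean_jamesLL hq0 hq1]
    have hA : ∏ i, (1 - ρ + ρ * lr q (z i)) ≤ Real.exp (n * ρ * lr q true) := by
      rw [mul_assoc, Real.exp_nat_mul]
      have h3 : Real.exp (ρ * lr q true) ^ n = ∏ _i : Fin n, Real.exp (ρ * lr q true) := by simp
      rw [h3]
      refine prod_le_prod (fun i _ => add_nonneg (by linarith)
        (mul_nonneg h0 (lr_pos hq0 hq1 _).le)) fun i _ => ?_
      have h2 : lr q (z i) ≤ lr q true := by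
        cases z i
        · simp only [lr, Bool.false_eq_true, if_false, if_true]
          rw [div_le_div_iff₀ (by linarith) hq0]; nlinarith
        · exact le_rfl
      have := mul_le_mul_of_nonneg_left h2 h0
      linarith [Real.add_one_le_exp (ρ * lr q true)]
    have hA0 : 0 ≤ ∏ i, (1 - ρ + ρ * lr q (z i)) := prod_nonneg fun i _ =>
      add_nonneg (by linarith) (mul_nonneg h0 (lr_pos hq0 hq1 _).le)
    have hB : noiseP q z * Real.exp (κ * (∑ i, lr q (z i) - (1 + η) * n))
        = prodWeight (fun a => ber q a * Real.exp (κ * (lr q a - 1 - η))) z := by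
      rw [noiseP_eq_prodWeight, prodWeight, prodWeight, prod_mul_distrib, ← Real.exp_sum,
        ← mul_sum, sum_sub_distrib, sum_sub_distrib]
      simp only [sum_const, card_univ, Fintype.card_fin, nsmul_eq_mul]
      congr 3; ring
    rw [← hB]
    calc _ ≤ noiseP q z * (Real.exp (n * ρ * lr q true)
          * Real.exp (κ * (∑ i, lr q (z i) - (1 + η) * n))) :=
          mul_le_mul_of_nonneg_left (mul_le_mul hA (indicator_lt_le_exp hκ)
            (ite_one_zero_nonneg _) (Real.exp_pos _).le) (noiseP_nonneg hq0.le hq1.le z)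
      _ = _ := by ring
  refine (sum_le_sum fun z _ => hin z).trans (le_of_eq ?_)
  rw [← sum_mul, sum_prodWeight, Fintype.card_fin]

end Parameters

end CovertComm

namespace CovertComm

open Finset

section CodeMean

variable {κ ι α : Type*} [Fintype κ] [Fintype ι]

/-- The average of `g` over all codewords of the keyed codebook `c`. -/
noncomputable def codeMean (c : κ → ι → α) (g : α → ℝ) : ℝ :=
  (1 / ((Fintype.card ι : ℝ) * Fintype.card κ)) * ∑ k, ∑ i, g (c k i)

/-- The weight of a keyed codebook with independent codewords drawn from `w`. -/
def ensemble (w : α → ℝ) (c : κ → ι → α) : ℝ := prodWeight (prodWeight w) c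

lemma ensemble_nonneg {w : α → ℝ} (hw0 : ∀ a, 0 ≤ w a) (c : κ → ι → α) : 0 ≤ ensemble w c :=
  prodWeight_nonneg (prodWeight_nonneg hw0) c

lemma codeMean_nonneg (c : κ → ι → α) {g : α → ℝ} (hg : ∀ a, 0 ≤ g a) : 0 ≤ codeMean c g :=
  mul_nonneg (by positivity) (sum_nonneg fun _ _ => sum_nonneg fun _ _ => hg _)

lemma codeMean_add (c : κ → ι → α) (g h : α → ℝ) :
    codeMean c (fun a => g a + h a) = codeMean c g + codeMean c h := by
  simp only [codeMean, sum_add_distrib, mul_add]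

lemma codeMean_const [Nonempty κ] [Nonempty ι] (c : κ → ι → α) (r : ℝ) :
    codeMean c (fun _ => r) = r := by
  have h1 : (Fintype.card κ : ℝ) ≠ 0 := by simp
  have h2 : (Fintype.card ι : ℝ) ≠ 0 := by simp
  simp [codeMean]; field_simp

variable [Fintype α] [DecidableEq κ] [DecidableEq ι]

lemma sum_prodWeight_eq_one {w : α → ℝ} (hw : ∑ a, w a = 1) :
    ∑ c : ι → α, prodWeight w c = 1 := by
  rw [sum_prodWeight, hw, one_pow]

lemma sum_ensemble {w : α → ℝ} (hw : ∑ a, w a = 1) :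
    ∑ c : κ → ι → α, ensemble w c = 1 :=
  sum_prodWeight_eq_one (sum_prodWeight_eq_one hw)

lemma mean_codeMean [Nonempty κ] [Nonempty ι] {w : α → ℝ} (hw : ∑ a, w a = 1) (g : α → ℝ) :
    ∑ c : κ → ι → α, ensemble w c * codeMean c g = ∑ a, w a * g a := by
  have h1 : (Fintype.card κ : ℝ) ≠ 0 := by simp
  have h2 : (Fintype.card ι : ℝ) ≠ 0 := by simp
  simp_rw [codeMean, mul_left_comm (ensemble w _), ← mul_sum, ensemble]
  rw [mean_sum (sum_prodWeight_eq_one hw) (fun x : ι → α => ∑ i, g (x i)), mean_sum hw]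
  field_simp

lemma mean_codeMean_sq [Nonempty κ] [Nonempty ι] {w : α → ℝ} (hw : ∑ a, w a = 1) {F : α → ℝ}
    (hF : ∑ a, w a * F a = 0) :
    ∑ c : κ → ι → α, ensemble w c * codeMean c F ^ 2
      = (1 / ((Fintype.card ι : ℝ) * Fintype.card κ)) * ∑ a, w a * F a ^ 2 := by
  have h1 : (Fintype.card κ : ℝ) ≠ 0 := by simp
  have h2 : (Fintype.card ι : ℝ) ≠ 0 := by simp
  have h3 : ∑ x : ι → α, prodWeight w x * ∑ i, F (x i) = 0 := by rw [mean_sum hw, hF, mul_zero]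
  simp_rw [codeMean, mul_pow, mul_left_comm (ensemble w _), ← mul_sum, ensemble]
  rw [mean_sum_sq (sum_prodWeight_eq_one hw) h3, mean_sum_sq hw hF]
  field_simp

lemma mean_abs_codeMean_le [Nonempty κ] [Nonempty ι] {w : α → ℝ} (hw0 : ∀ a, 0 ≤ w a)
    (hw : ∑ a, w a = 1) {F : α → ℝ} (hF : ∑ a, w a * F a = 0) {r v : ℝ} (hr : 0 < r)
    (hv : ∑ a, w a * F a ^ 2 ≤ v * (r ^ 2 * ((Fintype.card ι : ℝ) * Fintype.card κ))) :
    ∑ c : κ → ι → α, ensemble w c * |codeMean c F| ≤ r * ((1 + v) / 2) := by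
  have hM : 0 < (Fintype.card ι : ℝ) * Fintype.card κ := by
    have h1 : 0 < Fintype.card κ := Fintype.card_pos
    have h2 : 0 < Fintype.card ι := Fintype.card_pos
    positivity
  have hpt : ∀ c : κ → ι → α, ensemble w c * |codeMean c F|
      ≤ (1 / (2 * r)) * (ensemble w c * codeMean c F ^ 2) + r / 2 * ensemble w c := by
    intro c
    have h : |codeMean c F| ≤ (1 / (2 * r)) * codeMean c F ^ 2 + r / 2 := by
      rw [← sq_abs, ← sub_nonneg]
      have : (1 / (2 * r)) * |codeMean c F| ^ 2 + r / 2 - |codeMean c F|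
          = (|codeMean c F| - r) ^ 2 / (2 * r) := by field_simp; ring
      rw [this]; positivity
    have := mul_le_mul_of_nonneg_left h (ensemble_nonneg hw0 c)
    linarith
  refine (sum_le_sum fun c _ => hpt c).trans ?_
  rw [sum_add_distrib, ← mul_sum, ← mul_sum, sum_ensemble hw, mean_codeMean_sq hw hF]
  have h := mul_le_mul_of_nonneg_left hv
    (by positivity : 0 ≤ 1 / (2 * r) * (1 / ((Fintype.card ι : ℝ) * Fintype.card κ)))
  have h' : 1 / (2 * r) * (1 / ((Fintype.card ι : ℝ) * Fintype.card κ))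
      * (v * (r ^ 2 * ((Fintype.card ι : ℝ) * Fintype.card κ))) = r * v / 2 := by
    field_simp
  rw [h', mul_assoc] at h
  linarith

end CodeMean

section KeyedCode

variable {n N Δ : ℕ} {p q thr : ℝ}

open scoped Classical in
/-- The code with codebook `c` whose decoder outputs the unique message whose codeword passes the
score threshold, and declares silence otherwise. -/
noncomputable def keyedCode (p q thr : ℝ) (c : BV Δ → Fin N → BV n) : Code n N Δ where
  enc m k := c k m
  dec y k := if h : ∃! m, thr ≤ score p q (c k m) y then some h.choose else none

lemma keyedCode_dec_ne_none {c : BV Δ → Fin N → BV n} {y : BV n} {k : BV Δ}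
    (h : (keyedCode p q thr c).dec y k ≠ none) : ∃ m, thr ≤ score p q (c k m) y := by
  by_contra! h0
  refine h ?_
  simp only [keyedCode]
  rw [dif_neg]
  rintro ⟨m, hm, -⟩
  exact absurd hm (not_le.2 (h0 m))

lemma keyedCode_dec_ne_some {c : BV Δ → Fin N → BV n} {y : BV n} {k : BV Δ} {m : Fin N}
    (h : (keyedCode p q thr c).dec y k ≠ some m) :
    score p q (c k m) y < thr ∨ ∃ m', m' ≠ m ∧ thr ≤ score p q (c k m') y := by
  by_contra! h0
  refine h ?_
  have hu : ∃! m, thr ≤ score p q (c k m) y :=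
    ⟨m, h0.1, fun m' hm' => by
      by_contra hne
      exact absurd hm' (not_le.2 (h0.2 m' hne))⟩
  simp only [keyedCode]
  rw [dif_pos hu]
  exact congrArg some (hu.unique hu.choose_spec.1 h0.1)

lemma vxor_vxor_cancel (x z : BV n) : vxor x (vxor x z) = z := by
  funext i; simp [vxor]

lemma vxor_comm (x z : BV n) : vxor x z = vxor z x := by
  funext i; simp [vxor, Bool.xor_comm]

lemma sum_noiseP_vxor (q : ℝ) (x : BV n) (f : BV n → ℝ) :
    ∑ zb : BV n, noiseP q zb * f (vxor x zb) = ∑ z : BV n, noiseP q (vxor z x) * f z := by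
  have hinv : Function.Involutive (vxor x) := vxor_vxor_cancel x
  refine Fintype.sum_equiv hinv.toPerm _ _ fun zb => ?_
  rw [Function.Involutive.coe_toPerm, vxor_comm (vxor x zb), vxor_vxor_cancel]

lemma sum_jammer_le (J : Jammer n p) (z : BV n) {f : BV n → ℝ} {a : ℝ}
    (hf : ∀ s : BV n, (wt s : ℝ) ≤ p * n → f s ≤ a) : ∑ s, J.W z s * f s ≤ a := by
  have h : ∀ s ∈ univ, J.W z s * f s ≤ J.W z s * a := by
    intro s _
    by_cases hs : J.W z s = 0
    · simp [hs]
    · exact mul_le_mul_of_nonneg_left (hf s (J.wt_le z s hs)) (J.nonneg z s)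
  refine (sum_le_sum h).trans ?_
  rw [← sum_mul, J.sum_one, one_mul]

open scoped Classical in
lemma errSilent_keyedCode_le (hq0 : 0 ≤ q) (hq1 : q ≤ 1) (c : BV Δ → Fin N → BV n)
    (J : Jammer n p) {T : ℝ}
    (hT : ∀ s : BV n, (wt s : ℝ) ≤ p * n →
      ∑ k, (if ∃ m, thr ≤ score p q (c k m) s then (1 : ℝ) else 0) ≤ T) :
    errSilent q (keyedCode p q thr c) J ≤ T / 2 ^ Δ := by
  have hz : ∀ zb : BV n, ∑ s : BV n, J.W zb s * ∑ k,
      (if (keyedCode p q thr c).dec s k = Option.none then (0 : ℝ) else 1) ≤ T := by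
    intro zb
    refine sum_jammer_le J zb fun s hs => (sum_le_sum fun k _ => ?_).trans (hT s hs)
    split_ifs with h1 h2 h2
    · exact zero_le_one
    · exact le_rfl
    · exact le_rfl
    · exact absurd (keyedCode_dec_ne_none h1) h2
  have heq : ∑ k : BV Δ, ∑ zb : BV n, noiseP q zb * ∑ s : BV n, J.W zb s *
      (if (keyedCode p q thr c).dec s k = Option.none then (0 : ℝ) else 1)
      = ∑ zb : BV n, noiseP q zb * ∑ s : BV n, J.W zb s * ∑ k,
      (if (keyedCode p q thr c).dec s k = Option.none then (0 : ℝ) else 1) := by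
    rw [sum_comm]
    refine sum_congr rfl fun zb _ => ?_
    rw [← mul_sum, sum_comm]
    simp_rw [mul_sum]
  rw [errSilent, heq, one_div, inv_mul_eq_div]
  refine div_le_div_of_nonneg_right ?_ (by positivity)
  refine (sum_le_sum fun z _ => mul_le_mul_of_nonneg_left (hz z) (noiseP_nonneg hq0 hq1 z)).trans ?_
  rw [← sum_mul, sum_noiseP, one_mul]

/-- The likelihood ratio of the codeword `x`, truncated at level `exp b`. -/
noncomputable def truncLR (q b : ℝ) (z x : BV n) : ℝ :=
  if jamesLL q z x ≤ b then Real.exp (jamesLL q z x) else 0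

open scoped Classical in
/-- The mass of atypical pairs of observations and codewords. -/
noncomputable def atypMass (q b : ℝ) (G : BV n → Prop) (c : BV Δ → Fin N → BV n) : ℝ :=
  ∑ z : BV n, noiseP q z * codeMean c (fun x => Real.exp (jamesLL q z x)
    * ((if G z then 0 else 1) + (if b < jamesLL q z x then 1 else 0)))

lemma truncLR_nonneg (q b : ℝ) (z x : BV n) : 0 ≤ truncLR q b z x := by
  unfold truncLR; split_ifs
  · exact (Real.exp_pos _).le
  · exact le_rfl

open scoped Classical in
lemma exp_jamesLL_eq (q b : ℝ) (z x : BV n) : Real.exp (jamesLL q z x)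
    = truncLR q b z x + Real.exp (jamesLL q z x) * (if b < jamesLL q z x then 1 else 0) := by
  unfold truncLR
  rcases le_or_gt (jamesLL q z x) b with h | h
  · simp [h, not_lt.2 h]
  · simp [h, not_le.2 h]

lemma sum_comm_four {α β γ δ : Type*} [Fintype α] [Fintype β] [Fintype γ] [Fintype δ]
    (f : α → β → γ → δ → ℝ) :
    ∑ a, ∑ b, ∑ c, ∑ d, f a b c d = ∑ c, ∑ d, ∑ b, ∑ a, f a b c d := by
  calc _ = ∑ b, ∑ a, ∑ c, ∑ d, f a b c d := sum_comm
    _ = ∑ b, ∑ c, ∑ a, ∑ d, f a b c d := sum_congr rfl fun _ _ => sum_comm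
    _ = ∑ c, ∑ b, ∑ a, ∑ d, f a b c d := sum_comm
    _ = ∑ c, ∑ b, ∑ d, ∑ a, f a b c d :=
      sum_congr rfl fun _ _ => sum_congr rfl fun _ _ => sum_comm
    _ = _ := sum_congr rfl fun _ _ => sum_comm

open scoped Classical in
lemma errActive_keyedCode_le (hq0 : 0 < q) (hq1 : q < 1) (c : BV Δ → Fin N → BV n)
    (J : Jammer n p) {b T : ℝ} (G : BV n → Prop) (hT0 : 0 ≤ T)
    (hT : ∀ z s : BV n, G z → (wt s : ℝ) ≤ p * n →
      ∑ k, badWeight (truncLR q b z) (fun x => score p q x (vxor x s) < thr)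
        (fun x x' => thr ≤ score p q x' (vxor x s)) (c k) ≤ T) :
    errActive q (keyedCode p q thr c) J ≤ T / (N * 2 ^ Δ) + atypMass q b G c := by
  set e : Fin N → BV Δ → BV n → ℝ := fun m k s =>
    if (keyedCode p q thr c).dec (vxor (c k m) s) k = some m then 0 else 1 with he
  have he0 : ∀ m k s, 0 ≤ e m k s := fun m k s => by simp only [he]; split_ifs <;> simp
  have he1 : ∀ m k s, e m k s ≤ 1 := fun m k s => by simp only [he]; split_ifs <;> simp
  have hM : (0 : ℝ) ≤ 1 / (N * 2 ^ Δ) := by positivity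
  have hz : ∀ z : BV n, ∑ s : BV n, J.W z s * ((1 / (N * 2 ^ Δ)) * ∑ k, ∑ m,
        Real.exp (jamesLL q z (c k m)) * e m k s)
      ≤ T / (N * 2 ^ Δ) + codeMean c (fun x => Real.exp (jamesLL q z x)
        * ((if G z then 0 else 1) + (if b < jamesLL q z x then 1 else 0))) := by
    intro z
    refine sum_jammer_le J z fun s hs => ?_
    have hcm : ∀ g : BV n → ℝ, codeMean c g = (1 / (N * 2 ^ Δ)) * ∑ k, ∑ m, g (c k m) := by
      intro g; simp [codeMean]
    rw [hcm, div_eq_mul_one_div T, mul_comm T, ← mul_add]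
    refine mul_le_mul_of_nonneg_left ?_ hM
    by_cases hG : G z
    · refine le_trans ?_ (add_le_add_left (hT z s hG hs) _)
      rw [← sum_add_distrib]
      refine sum_le_sum fun k _ => ?_
      rw [badWeight, ← sum_add_distrib]
      refine sum_le_sum fun m _ => ?_
      simp only [hG, if_true, zero_add]
      rw [exp_jamesLL_eq q b z (c k m), add_mul]
      rw [← exp_jamesLL_eq q b z (c k m)]
      refine add_le_add (mul_le_mul_of_nonneg_left ?_ (truncLR_nonneg _ _ _ _))
        (mul_le_of_le_one_right (mul_nonneg (Real.exp_pos _).le (ite_one_zero_nonneg _)) (he1 _ _ _))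
      simp only [he]
      split_ifs with h1 h2 h2
      · exact zero_le_one
      · exact le_rfl
      · exact le_rfl
      · exact absurd (keyedCode_dec_ne_some h1) h2
    · refine le_trans ?_ (le_add_of_nonneg_left hT0)
      refine sum_le_sum fun k _ => sum_le_sum fun m _ =>
        mul_le_mul_of_nonneg_left ((he1 _ _ _).trans ?_) (Real.exp_pos _).le
      simp only [hG, if_false, le_add_iff_nonneg_right]
      exact ite_one_zero_nonneg _
  have heq : errActive q (keyedCode p q thr c) J = ∑ z : BV n, noiseP q z * ∑ s : BV n,
      J.W z s * ((1 / (N * 2 ^ Δ)) * ∑ k, ∑ m, Real.exp (jamesLL q z (c k m)) * e m k s) := by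
    have h1 : ∀ m k, ∑ zb : BV n, noiseP q zb * ∑ s : BV n,
        J.W (vxor ((keyedCode p q thr c).enc m k) zb) s *
        (if (keyedCode p q thr c).dec (vxor ((keyedCode p q thr c).enc m k) s) k = some m
          then (0 : ℝ) else 1)
        = ∑ z : BV n, ∑ s : BV n, noiseP q z * (J.W z s
          * (Real.exp (jamesLL q z (c k m)) * e m k s)) := by
      intro m k
      rw [sum_noiseP_vxor q _ fun z => ∑ s : BV n, J.W z s *
        (if (keyedCode p q thr c).dec (vxor ((keyedCode p q thr c).enc m k) s) k = some m
          then (0 : ℝ) else 1)]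
      refine sum_congr rfl fun z _ => ?_
      rw [noiseP_vxor hq0 hq1, mul_sum]
      refine sum_congr rfl fun s _ => ?_
      simp only [he, keyedCode]
      ring
    rw [errActive]
    simp_rw [h1]
    rw [sum_comm_four]
    simp_rw [mul_sum]
    exact sum_congr rfl fun z _ => sum_congr rfl fun s _ => sum_congr rfl fun k _ =>
      sum_congr rfl fun m _ => by ring
  rw [heq, atypMass]
  refine (sum_le_sum fun z _ => mul_le_mul_of_nonneg_left (hz z)
    (noiseP_nonneg hq0.le hq1.le z)).trans (le_of_eq ?_)
  simp_rw [mul_add, sum_add_distrib, ← sum_mul, sum_noiseP, one_mul]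

end KeyedCode

end CovertComm

namespace CovertComm

open Finset

section OneShot

variable {n N Δ : ℕ} {p q ρ thr b : ℝ}

/-- The output distribution of the random codeword relative to the noise distribution. -/
noncomputable def avgLR (q ρ : ℝ) (z : BV n) : ℝ := ∏ i, (1 - ρ + ρ * lr q (z i))

/-- The mean deviation of the code's output likelihood ratio from its ensemble average. -/
noncomputable def deviation (q ρ : ℝ) (c : BV Δ → Fin N → BV n) : ℝ :=
  ∑ z : BV n, noiseP q z * |codeMean c (fun x => Real.exp (jamesLL q z x)) - avgLR q ρ z|

lemma PMD_keyedCode (hq0 : 0 < q) (hq1 : q < 1) (c : BV Δ → Fin N → BV n) (Φ : BV n → Bool) :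
    PMD q (keyedCode p q thr c) Φ = ∑ z : BV n, noiseP q z *
      (codeMean c (fun x => Real.exp (jamesLL q z x)) * (if Φ z then 0 else 1)) := by
  have h : ∀ (f : Fin N → BV Δ → BV n → ℝ), ∑ m, ∑ k, ∑ z, f m k z = ∑ z, ∑ k, ∑ m, f m k z := by
    intro f
    calc _ = ∑ k, ∑ m, ∑ z, f m k z := sum_comm
      _ = ∑ k, ∑ z, ∑ m, f m k z := sum_congr rfl fun _ _ => sum_comm
      _ = _ := sum_comm
  rw [PMD, h, mul_sum]
  refine sum_congr rfl fun z _ => ?_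
  simp only [codeMean, mul_sum, sum_mul, keyedCode, noiseP_vxor hq0 hq1]
  simp only [Fintype.card_fin, Fintype.card_pi, Fintype.card_bool, prod_const, card_univ,
    Nat.cast_pow, Nat.cast_ofNat]
  exact sum_congr rfl fun k _ => sum_congr rfl fun m _ => by ring

lemma covertGap_keyedCode_ge (hq0 : 0 < q) (hq1 : q < 1) (c : BV Δ → Fin N → BV n) :
    ∑ z : BV n, noiseP q z * min 1 (avgLR q ρ z) - deviation q ρ c
      ≤ covertGap q (keyedCode p q thr c) := by
  refine le_ciInf fun Φ => ?_
  rw [PFA, PMD_keyedCode hq0 hq1, deviation, ← sum_sub_distrib, ← sum_add_distrib]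
  refine sum_le_sum fun z _ => ?_
  rw [← mul_sub, ← mul_add]
  refine mul_le_mul_of_nonneg_left ?_ (noiseP_nonneg hq0.le hq1.le z)
  set a := codeMean c (fun x => Real.exp (jamesLL q z x))
  cases Φ z
  · simp only [Bool.false_eq_true, if_false, mul_one, zero_add]
    linarith [min_le_right 1 (avgLR q ρ z), neg_abs_le (a - avgLR q ρ z)]
  · simp only [if_true, mul_zero, add_zero]
    linarith [min_le_left 1 (avgLR q ρ z), abs_nonneg (a - avgLR q ρ z)]

lemma sum_noiseP_mul_exp_jamesLL (hq0 : 0 < q) (hq1 : q < 1) (x : BV n) :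
    ∑ z : BV n, noiseP q z * Real.exp (jamesLL q z x) = 1 := by
  simp_rw [← noiseP_vxor hq0 hq1]
  have := sum_noiseP_vxor q x fun _ => 1
  simp only [mul_one] at this
  rw [← this, sum_noiseP]

lemma sum_noiseP_mul_avgLR (hq0 : 0 < q) (hq1 : q < 1) :
    ∑ z : BV n, noiseP q z * avgLR q ρ z = 1 := by
  simp_rw [avgLR, ← mean_jamesLL hq0 hq1, mul_sum]
  rw [sum_comm]
  simp_rw [mul_left_comm (noiseP q _), ← mul_sum, sum_noiseP_mul_exp_jamesLL hq0 hq1, mul_one]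
  exact sum_noiseP ρ

instance jammer_nonempty [hp : Fact (0 ≤ p)] : Nonempty (Jammer n p) :=
  ⟨{ W := fun _ s => if s = fun _ => false then 1 else 0
     nonneg := fun _ s => by split_ifs <;> simp
     sum_one := fun _ => by simp
     wt_le := fun _ s h => by
      have hs : s = fun _ => false := by by_contra h'; simp [h'] at h
      have : wt s = 0 := by simp [hs, wt]
      rw [this, Nat.cast_zero]
      exact mul_nonneg hp.out (Nat.cast_nonneg n) }⟩

open scoped Classical in
lemma Perr_keyedCode_le (hp0 : 0 ≤ p) (hq0 : 0 < q) (hq1 : q < 1) (c : BV Δ → Fin N → BV n)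
    {T T' : ℝ} (G : BV n → Prop) (hT0 : 0 ≤ T)
    (hT : ∀ z s : BV n, G z → (wt s : ℝ) ≤ p * n →
      ∑ k, badWeight (truncLR q b z) (fun x => score p q x (vxor x s) < thr)
        (fun x x' => thr ≤ score p q x' (vxor x s)) (c k) ≤ T)
    (hT' : ∀ s : BV n, (wt s : ℝ) ≤ p * n →
      ∑ k, (if ∃ m, thr ≤ score p q (c k m) s then (1 : ℝ) else 0) ≤ T') :
    Perr p q (keyedCode p q thr c) ≤ T' / 2 ^ Δ + (T / (N * 2 ^ Δ) + atypMass q b G c) := by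
  have : Fact (0 ≤ p) := ⟨hp0⟩
  exact ciSup_le fun J => add_le_add (errSilent_keyedCode_le hq0.le hq1.le c J hT')
    (errActive_keyedCode_le hq0 hq1 c J G hT0 hT)

lemma Perr_nonneg (hq0 : 0 ≤ q) (hq1 : q ≤ 1) (C : Code n N Δ) : 0 ≤ Perr p q C := by
  refine Real.iSup_nonneg fun J => add_nonneg ?_ ?_
  · refine mul_nonneg (by positivity) (sum_nonneg fun k _ => sum_nonneg fun z _ =>
      mul_nonneg (noiseP_nonneg hq0 hq1 z) (sum_nonneg fun s _ => mul_nonneg (J.nonneg z s) ?_))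
    split_ifs <;> simp
  · refine mul_nonneg (by positivity) (sum_nonneg fun m _ => sum_nonneg fun k _ =>
      sum_nonneg fun z _ => mul_nonneg (noiseP_nonneg hq0 hq1 z) (sum_nonneg fun s _ =>
      mul_nonneg (J.nonneg _ s) ?_))
    split_ifs <;> simp

open scoped Classical in
/-- The ensemble mean of the mass of atypical pairs. -/
noncomputable def meanAtyp (q ρ b : ℝ) (G : BV n → Prop) : ℝ :=
  ∑ z : BV n, noiseP q z * ∑ x : BV n, noiseP ρ x * (Real.exp (jamesLL q z x)
    * ((if G z then 0 else 1) + (if b < jamesLL q z x then 1 else 0)))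

open scoped Classical in
lemma mean_atypMass (hN : 0 < N) (G : BV n → Prop) :
    ∑ c : BV Δ → Fin N → BV n, ensemble (noiseP ρ) c * atypMass q b G c = meanAtyp q ρ b G := by
  have : Nonempty (Fin N) := ⟨⟨0, hN⟩⟩
  simp_rw [atypMass, mul_sum]
  rw [sum_comm, meanAtyp]
  refine sum_congr rfl fun z _ => ?_
  simp_rw [mul_left_comm (ensemble _ _), ← mul_sum]
  rw [mean_codeMean (sum_noiseP ρ)]

open scoped Classical in
lemma mean_deviation_le (hq0 : 0 < q) (hq1 : q < 1) (h0 : 0 ≤ ρ) (h1 : ρ ≤ 1) (hN : 0 < N)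
    (G : BV n → Prop) {r : ℝ} (hr : 0 < r) (hrM : Real.exp b ≤ r ^ 2 * ((N : ℝ) * 2 ^ Δ)) :
    ∑ c : BV Δ → Fin N → BV n, ensemble (noiseP ρ) c * deviation q ρ c
      ≤ r + 2 * meanAtyp q ρ b G := by
  have : Nonempty (Fin N) := ⟨⟨0, hN⟩⟩
  have hw := sum_noiseP (n := n) ρ
  have hw0 : ∀ x : BV n, 0 ≤ noiseP ρ x := noiseP_nonneg h0 h1
  set tail : BV n → BV n → ℝ := fun z x =>
    Real.exp (jamesLL q z x) * (if b < jamesLL q z x then 1 else 0) with htail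
  have htail0 : ∀ z x, 0 ≤ tail z x := fun z x =>
    mul_nonneg (Real.exp_pos _).le (ite_one_zero_nonneg _)
  have hz : ∀ z : BV n, ∑ c : BV Δ → Fin N → BV n, ensemble (noiseP ρ) c
        * |codeMean c (fun x => Real.exp (jamesLL q z x)) - avgLR q ρ z|
      ≤ r * ((1 + avgLR q ρ z) / 2) + 2 * ∑ x, noiseP ρ x * tail z x := by
    intro z
    set μ := ∑ x, noiseP ρ x * truncLR q b z x with hμ
    set ν := ∑ x, noiseP ρ x * tail z x with hν
    have hA : avgLR q ρ z = μ + ν := by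
      rw [avgLR, ← mean_jamesLL hq0 hq1, hμ, hν, ← sum_add_distrib]
      refine sum_congr rfl fun x _ => ?_
      rw [← mul_add, htail, ← exp_jamesLL_eq]
    have hν0 : 0 ≤ ν := sum_nonneg fun x _ => mul_nonneg (hw0 x) (htail0 z x)
    have hμ0 : 0 ≤ μ := sum_nonneg fun x _ => mul_nonneg (hw0 x) (truncLR_nonneg _ _ _ _)
    have hF : ∑ x, noiseP ρ x * (truncLR q b z x + -μ) = 0 := by
      simp_rw [mul_add, sum_add_distrib, ← sum_mul, hw, ← hμ]; ring
    have hF2 : ∑ x, noiseP ρ x * (truncLR q b z x + -μ) ^ 2 ≤ avgLR q ρ z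
        * (r ^ 2 * ((Fintype.card (Fin N) : ℝ) * Fintype.card (BV Δ))) := by
      have e1 : ∑ x, noiseP ρ x * (truncLR q b z x + -μ) ^ 2
          = ∑ x, noiseP ρ x * truncLR q b z x ^ 2 - μ ^ 2 := by
        have : ∀ x, noiseP ρ x * (truncLR q b z x + -μ) ^ 2
            = noiseP ρ x * truncLR q b z x ^ 2 - 2 * μ * (noiseP ρ x * truncLR q b z x)
              + μ ^ 2 * noiseP ρ x := fun x => by ring
        simp_rw [this]
        rw [sum_add_distrib, sum_sub_distrib, ← mul_sum, ← mul_sum, hw, ← hμ]; ring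
      have e2 : ∑ x, noiseP ρ x * truncLR q b z x ^ 2 ≤ Real.exp b * μ := by
        rw [hμ, mul_sum]
        refine sum_le_sum fun x _ => ?_
        have h2 : truncLR q b z x ≤ Real.exp b := by
          unfold truncLR; split_ifs with h
          · exact Real.exp_le_exp.2 h
          · exact (Real.exp_pos _).le
        have h3 := truncLR_nonneg q b z x
        have h4 := hw0 x
        have := mul_le_mul_of_nonneg_left h2 (mul_nonneg h4 h3)
        nlinarith
      have e3 : Real.exp b * μ ≤ r ^ 2 * ((N : ℝ) * 2 ^ Δ) * avgLR q ρ z :=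
        mul_le_mul hrM (by linarith) hμ0 (by positivity)
      have e4 : ((Fintype.card (Fin N) : ℝ) * Fintype.card (BV Δ)) = (N : ℝ) * 2 ^ Δ := by simp
      rw [e1, e4]
      nlinarith [sq_nonneg μ]
    have hdev := mean_abs_codeMean_le (κ := BV Δ) (ι := Fin N) hw0 hw hF hr hF2
    have hpt : ∀ c : BV Δ → Fin N → BV n, ensemble (noiseP ρ) c
          * |codeMean c (fun x => Real.exp (jamesLL q z x)) - avgLR q ρ z|
        ≤ ensemble (noiseP ρ) c * |codeMean c (fun x => truncLR q b z x + -μ)|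
          + ensemble (noiseP ρ) c * codeMean c (tail z) + ν * ensemble (noiseP ρ) c := by
      intro c
      have hs : codeMean c (fun x => Real.exp (jamesLL q z x)) - avgLR q ρ z
          = codeMean c (fun x => truncLR q b z x + -μ) + codeMean c (tail z) - ν := by
        rw [codeMean_add, codeMean_const, hA]
        have : (fun x => Real.exp (jamesLL q z x)) = fun x => truncLR q b z x + tail z x :=
          funext fun x => exp_jamesLL_eq q b z x
        rw [this, codeMean_add]; ring
      have h3 : |codeMean c (fun x => Real.exp (jamesLL q z x)) - avgLR q ρ z|
          ≤ |codeMean c (fun x => truncLR q b z x + -μ)| + codeMean c (tail z) + ν := by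
        rw [hs]
        have := codeMean_nonneg c (htail0 z)
        refine (abs_sub _ _).trans ?_
        rw [abs_of_nonneg hν0]
        refine add_le_add_left ((abs_add_le _ _).trans ?_) _
        rw [abs_of_nonneg this]
      have := mul_le_mul_of_nonneg_left h3 (ensemble_nonneg hw0 c)
      linarith
    refine (sum_le_sum fun c _ => hpt c).trans ?_
    rw [sum_add_distrib, sum_add_distrib, ← mul_sum, sum_ensemble hw, mean_codeMean hw]
    linarith
  have hcomm : ∑ c : BV Δ → Fin N → BV n, ensemble (noiseP ρ) c * deviation q ρ c
      = ∑ z : BV n, noiseP q z * ∑ c : BV Δ → Fin N → BV n, ensemble (noiseP ρ) c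
        * |codeMean c (fun x => Real.exp (jamesLL q z x)) - avgLR q ρ z| := by
    simp_rw [deviation, mul_sum]
    rw [sum_comm]
    simp_rw [mul_left_comm (ensemble _ _)]
  rw [hcomm]
  refine (sum_le_sum fun z _ => mul_le_mul_of_nonneg_left (hz z)
    (noiseP_nonneg hq0.le hq1.le z)).trans ?_
  have e5 : ∀ z : BV n, noiseP q z * (r * ((1 + avgLR q ρ z) / 2)
        + 2 * ∑ x, noiseP ρ x * tail z x)
      = r / 2 * noiseP q z + r / 2 * (noiseP q z * avgLR q ρ z)
        + 2 * (noiseP q z * ∑ x, noiseP ρ x * tail z x) := fun z => by ring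
  simp_rw [e5]
  rw [sum_add_distrib, sum_add_distrib, ← mul_sum, ← mul_sum, ← mul_sum, sum_noiseP,
    sum_noiseP_mul_avgLR hq0 hq1]
  have e6 : ∑ z : BV n, noiseP q z * ∑ x, noiseP ρ x * tail z x ≤ meanAtyp q ρ b G := by
    refine sum_le_sum fun z _ => mul_le_mul_of_nonneg_left (sum_le_sum fun x _ =>
      mul_le_mul_of_nonneg_left (mul_le_mul_of_nonneg_left ?_ (Real.exp_pos _).le) (hw0 x))
      (noiseP_nonneg hq0.le hq1.le z)
    refine le_add_of_nonneg_left ?_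
    split_ifs <;> simp
  linarith

end OneShot

end CovertComm

namespace CovertComm

open Finset

section Existence

variable {n N Δ : ℕ} {p q ρ thr b : ℝ}

open scoped Classical in
lemma mean_exists_badWeight_le (h0 : 0 ≤ ρ) (h1 : ρ ≤ 1) (G : BV n → Prop)
    {lam w₀ d₁ d₂ T : ℝ} (hl : 0 ≤ lam) (hlb : lam * Real.exp b ≤ 1)
    (hw₀ : ∀ z, G z → ∑ x : BV n, noiseP ρ x * Real.exp (jamesLL q z x) ≤ w₀)
    (hlN : lam * N * w₀ ≤ 1)
    (hd₁ : ∀ z s : BV n, G z → (wt s : ℝ) ≤ p * n → ∑ x : BV n, noiseP ρ x *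
      (Real.exp (jamesLL q z x) * (if score p q x (vxor x s) < thr then 1 else 0)) ≤ d₁)
    (hd₂ : ∀ z s : BV n, G z → (wt s : ℝ) ≤ p * n →
      ∑ x : BV n, ∑ x' : BV n, noiseP ρ x * noiseP ρ x' * (Real.exp (jamesLL q z x)
        * (if thr ≤ score p q x' (vxor x s) then 1 else 0)) ≤ d₂) :
    ∑ c : BV Δ → Fin N → BV n, ensemble (noiseP ρ) c
      * (if ∃ z s : BV n, G z ∧ (wt s : ℝ) ≤ p * n ∧
        T < ∑ k, badWeight (truncLR q b z) (fun x => score p q x (vxor x s) < thr)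
          (fun x x' => thr ≤ score p q x' (vxor x s)) (c k) then 1 else 0)
      ≤ 4 ^ n * Real.exp (2 ^ Δ * (Real.exp 4 * (lam * N * (d₁ + N * d₂))) - lam * T) := by
  have hw := sum_noiseP (n := n) ρ
  have hw0 : ∀ x : BV n, 0 ≤ noiseP ρ x := noiseP_nonneg h0 h1
  have htr : ∀ z x : BV n, truncLR q b z x ≤ Real.exp (jamesLL q z x) := by
    intro z x; unfold truncLR; split_ifs
    · exact le_rfl
    · exact (Real.exp_pos _).le
  set V : BV n → BV n → (Fin N → BV n) → ℝ := fun z s =>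
    badWeight (truncLR q b z) (fun x => score p q x (vxor x s) < thr)
          (fun x x' => thr ≤ score p q x' (vxor x s)) with hV
  have hzs : ∀ z s : BV n, G z → (wt s : ℝ) ≤ p * n →
      ∑ c : BV Δ → Fin N → BV n, ensemble (noiseP ρ) c * (if T < ∑ k, V z s (c k) then 1 else 0)
      ≤ Real.exp (2 ^ Δ * (Real.exp 4 * (lam * N * (d₁ + N * d₂))) - lam * T) := by
    intro z s hG hs
    have hm := mean_exp_badWeight_le (N := N) hw0 hw (truncLR_nonneg q b z)
      (fun x => score p q x (vxor x s) < thr) (fun x x' => thr ≤ score p q x' (vxor x s))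
      (lam := lam) (w₀ := w₀) (d₁ := d₁) (d₂ := d₂) hl
      (fun x => by
        refine le_trans (mul_le_mul_of_nonneg_left ?_ hl) hlb
        unfold truncLR; split_ifs with h
        · exact Real.exp_le_exp.2 h
        · exact (Real.exp_pos _).le)
      ((sum_le_sum fun x _ => mul_le_mul_of_nonneg_left (htr z x) (hw0 x)).trans (hw₀ z hG)) hlN
      ((sum_le_sum fun x _ => mul_le_mul_of_nonneg_left (mul_le_mul_of_nonneg_right (htr z x)
        (ite_one_zero_nonneg _)) (hw0 x)).trans (hd₁ z s hG hs))
      ((sum_le_sum fun x _ => sum_le_sum fun x' _ => mul_le_mul_of_nonneg_left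
        (mul_le_mul_of_nonneg_right (htr z x) (ite_one_zero_nonneg _))
        (mul_nonneg (hw0 x) (hw0 x'))).trans (hd₂ z s hG hs))
    have := chernoff (ι := BV Δ) (T := T) (prodWeight_nonneg hw0) (V z s) hl hm
    simpa [ensemble] using this
  have hun : ∀ c : BV Δ → Fin N → BV n, ensemble (noiseP ρ) c
      * (if ∃ z s : BV n, G z ∧ (wt s : ℝ) ≤ p * n ∧ T < ∑ k, V z s (c k) then (1 : ℝ) else 0)
      ≤ ∑ z : BV n, ∑ s : BV n, if G z ∧ (wt s : ℝ) ≤ p * n then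
        ensemble (noiseP ρ) c * (if T < ∑ k, V z s (c k) then 1 else 0) else 0 := by
    intro c
    have hc := ensemble_nonneg hw0 c
    have hnn : ∀ z s : BV n, 0 ≤ if G z ∧ (wt s : ℝ) ≤ p * n then
        ensemble (noiseP ρ) c * (if T < ∑ k, V z s (c k) then (1 : ℝ) else 0) else 0 := by
      intro z s
      split_ifs <;> simp [hc]
    by_cases h : ∃ z s : BV n, G z ∧ (wt s : ℝ) ≤ p * n ∧ T < ∑ k, V z s (c k)
    · obtain ⟨z, s, hG, hs, hT⟩ := h
      rw [if_pos ⟨z, s, hG, hs, hT⟩]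
      refine le_trans ?_ (single_le_sum (fun z _ => sum_nonneg fun s _ => hnn z s) (mem_univ z))
      refine le_trans ?_ (single_le_sum (fun s _ => hnn z s) (mem_univ s))
      rw [if_pos ⟨hG, hs⟩, if_pos hT]
    · rw [if_neg h, mul_zero]
      exact sum_nonneg fun z _ => sum_nonneg fun s _ => hnn z s
  refine (sum_le_sum fun c _ => hun c).trans ?_
  rw [sum_comm]
  have hcard : (4 : ℝ) ^ n * Real.exp (2 ^ Δ * (Real.exp 4 * (lam * N * (d₁ + N * d₂))) - lam * T)
      = ∑ _z : BV n, ∑ _s : BV n,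
        Real.exp (2 ^ Δ * (Real.exp 4 * (lam * N * (d₁ + N * d₂))) - lam * T) := by
    simp only [sum_const, card_univ, Fintype.card_fun, Fintype.card_bool, Fintype.card_fin,
      nsmul_eq_mul, Nat.cast_pow, Nat.cast_ofNat]
    rw [← mul_assoc ((2 : ℝ) ^ n), ← mul_pow]; norm_num
  rw [hcard]
  refine sum_le_sum fun z _ => ?_
  rw [sum_comm]
  refine sum_le_sum fun s _ => ?_
  by_cases h : G z ∧ (wt s : ℝ) ≤ p * n
  · simp only [h, and_self, if_true]
    exact hzs z s h.1 h.2
  · simp only [h, if_false, sum_const_zero]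
    exact (Real.exp_pos _).le

open scoped Classical in
lemma mean_exists_false_alarm_le (hp0 : 0 < p) (hpq : p < q) (hq1 : q < 1) (h0 : 0 ≤ ρ)
    (h1 : ρ ≤ 1) {T : ℝ} :
    ∑ c : BV Δ → Fin N → BV n, ensemble (noiseP ρ) c
      * (if ∃ s : BV n, (wt s : ℝ) ≤ p * n ∧
        T < ∑ k, (if ∃ m, thr ≤ score p q (c k m) s then (1 : ℝ) else 0) then 1 else 0)
      ≤ 2 ^ n * Real.exp (2 ^ Δ * (2 * (N * Real.exp (-thr))) - T) := by
  have hw := sum_noiseP (n := n) ρ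
  have hw0 : ∀ x : BV n, 0 ≤ noiseP ρ x := noiseP_nonneg h0 h1
  set V : BV n → (Fin N → BV n) → ℝ := fun s x =>
    if ∃ m, thr ≤ score p q (x m) s then (1 : ℝ) else 0 with hV
  have hs' : ∀ s : BV n, (wt s : ℝ) ≤ p * n →
      ∑ c : BV Δ → Fin N → BV n, ensemble (noiseP ρ) c * (if T < ∑ k, V s (c k) then 1 else 0)
      ≤ Real.exp (2 ^ Δ * (2 * (N * Real.exp (-thr))) - T) := by
    intro s hs
    have hm : ∑ x : Fin N → BV n, prodWeight (noiseP ρ) x * Real.exp (1 * V s x)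
        ≤ 1 + 2 * (N * Real.exp (-thr)) := by
      have hpt : ∀ x : Fin N → BV n, prodWeight (noiseP ρ) x * Real.exp (1 * V s x)
          ≤ prodWeight (noiseP ρ) x + 2 * (prodWeight (noiseP ρ) x
            * ∑ m, (if thr ≤ score p q (x m) s then (1 : ℝ) else 0)) := by
        intro x
        have hv0 : 0 ≤ V s x := ite_one_zero_nonneg _
        have hv1 : V s x ≤ 1 := by simp only [hV]; split_ifs <;> simp
        have hv2 : V s x ≤ ∑ m, (if thr ≤ score p q (x m) s then (1 : ℝ) else 0) := by
          simp only [hV]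
          split_ifs with h
          · obtain ⟨m, hm⟩ := h
            refine le_trans ?_ (single_le_sum (fun m _ => ite_one_zero_nonneg _) (mem_univ m))
            rw [if_pos hm]
          · exact sum_nonneg fun m _ => ite_one_zero_nonneg _
        have h3 := exp_le_one_add_two_mul hv0 hv1
        rw [one_mul]
        have := mul_le_mul_of_nonneg_left (h3.trans (by linarith :
          1 + 2 * V s x ≤ 1 + 2 * ∑ m, (if thr ≤ score p q (x m) s then (1 : ℝ) else 0)))
          (prodWeight_nonneg hw0 x)
        linarith
      refine (sum_le_sum fun x _ => hpt x).trans ?_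
      rw [sum_add_distrib, ← mul_sum, sum_prodWeight_eq_one hw,
        mean_sum hw (fun y => if thr ≤ score p q y s then (1 : ℝ) else 0), Fintype.card_fin]
      have := mul_le_mul_of_nonneg_left (mean_false_alarm_le hp0 hpq hq1 h0 h1 (thr := thr) hs)
        (Nat.cast_nonneg N : (0 : ℝ) ≤ N)
      linarith
    have := chernoff (ι := BV Δ) (T := T) (prodWeight_nonneg hw0) (V s) zero_le_one hm
    simpa [ensemble] using this
  have hun : ∀ c : BV Δ → Fin N → BV n, ensemble (noiseP ρ) c
      * (if ∃ s : BV n, (wt s : ℝ) ≤ p * n ∧ T < ∑ k, V s (c k) then (1 : ℝ) else 0)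
      ≤ ∑ s : BV n, if (wt s : ℝ) ≤ p * n then
        ensemble (noiseP ρ) c * (if T < ∑ k, V s (c k) then 1 else 0) else 0 := by
    intro c
    have hc := ensemble_nonneg hw0 c
    have hnn : ∀ s : BV n, 0 ≤ if (wt s : ℝ) ≤ p * n then
        ensemble (noiseP ρ) c * (if T < ∑ k, V s (c k) then (1 : ℝ) else 0) else 0 := by
      intro s
      split_ifs <;> simp [hc]
    by_cases h : ∃ s : BV n, (wt s : ℝ) ≤ p * n ∧ T < ∑ k, V s (c k)
    · obtain ⟨s, hs, hT⟩ := h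
      rw [if_pos ⟨s, hs, hT⟩]
      refine le_trans ?_ (single_le_sum (fun s _ => hnn s) (mem_univ s))
      rw [if_pos hs, if_pos hT]
    · rw [if_neg h, mul_zero]
      exact sum_nonneg fun s _ => hnn s
  refine (sum_le_sum fun c _ => hun c).trans ?_
  rw [sum_comm]
  have hcard : (2 : ℝ) ^ n * Real.exp (2 ^ Δ * (2 * (N * Real.exp (-thr))) - T)
      = ∑ _s : BV n, Real.exp (2 ^ Δ * (2 * (N * Real.exp (-thr))) - T) := by
    simp only [sum_const, card_univ, Fintype.card_fun, Fintype.card_bool, Fintype.card_fin,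
      nsmul_eq_mul, Nat.cast_pow, Nat.cast_ofNat]
  rw [hcard]
  refine sum_le_sum fun s _ => ?_
  by_cases h : (wt s : ℝ) ≤ p * n
  · simp only [h, if_true]
    exact hs' s h
  · simp only [h, if_false, sum_const_zero]
    exact (Real.exp_pos _).le

open scoped Classical in
/-- The random coding bound: some code in the ensemble is simultaneously reliable and covert. -/
theorem exists_code (hp0 : 0 < p) (hpq : p < q) (hq1 : q < 1) (h0 : 0 ≤ ρ) (h1 : ρ ≤ 1)
    (hN : 0 < N) (G : BV n → Prop) {lam w₀ d₁ d₂ T T' r ν : ℝ} (hT0 : 0 ≤ T)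
    (hr : 0 < r) (hrM : Real.exp b ≤ r ^ 2 * ((N : ℝ) * 2 ^ Δ))
    (hl : 0 ≤ lam) (hlb : lam * Real.exp b ≤ 1)
    (hw₀ : ∀ z, G z → ∑ x : BV n, noiseP ρ x * Real.exp (jamesLL q z x) ≤ w₀)
    (hlN : lam * N * w₀ ≤ 1)
    (hd₁ : ∀ z s : BV n, G z → (wt s : ℝ) ≤ p * n → ∑ x : BV n, noiseP ρ x *
      (Real.exp (jamesLL q z x) * (if score p q x (vxor x s) < thr then 1 else 0)) ≤ d₁)
    (hd₂ : ∀ z s : BV n, G z → (wt s : ℝ) ≤ p * n →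
      ∑ x : BV n, ∑ x' : BV n, noiseP ρ x * noiseP ρ x' * (Real.exp (jamesLL q z x)
        * (if thr ≤ score p q x' (vxor x s) then 1 else 0)) ≤ d₂)
    (hν : r + 3 * meanAtyp q ρ b G
      + 4 ^ n * Real.exp (2 ^ Δ * (Real.exp 4 * (lam * N * (d₁ + N * d₂))) - lam * T)
      + 2 ^ n * Real.exp (2 ^ Δ * (2 * (N * Real.exp (-thr))) - T') ≤ ν) (hν1 : ν < 1) :
    ∃ C : Code n N Δ, Perr p q C ≤ T' / 2 ^ Δ + T / (N * 2 ^ Δ) + ν ∧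
      ∑ z : BV n, noiseP q z * min 1 (avgLR q ρ z) - ν ≤ covertGap q C := by
  have hq0 : 0 < q := hp0.trans hpq
  have hw := sum_noiseP (n := n) ρ
  have hw0 : ∀ x : BV n, 0 ≤ noiseP ρ x := noiseP_nonneg h0 h1
  set A : (BV Δ → Fin N → BV n) → Prop := fun c => ∃ z s : BV n, G z ∧ (wt s : ℝ) ≤ p * n ∧
        T < ∑ k, badWeight (truncLR q b z) (fun x => score p q x (vxor x s) < thr)
          (fun x x' => thr ≤ score p q x' (vxor x s)) (c k) with hA
  set A' : (BV Δ → Fin N → BV n) → Prop := fun c => ∃ s : BV n, (wt s : ℝ) ≤ p * n ∧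
        T' < ∑ k, (if ∃ m, thr ≤ score p q (c k m) s then (1 : ℝ) else 0) with hA'
  obtain ⟨c, hc⟩ := exists_le_mean (ensemble_nonneg (κ := BV Δ) (ι := Fin N) hw0)
    (sum_ensemble hw) fun c => deviation q ρ c + atypMass q b G c
      + (if A c then 1 else 0) + (if A' c then 1 else 0)
  simp_rw [mul_add, sum_add_distrib] at hc
  rw [mean_atypMass hN] at hc
  have hc1 := mean_deviation_le (Δ := Δ) hq0 hq1 h0 h1 hN G hr hrM
  have hc2 := mean_exists_badWeight_le (N := N) (Δ := Δ) (T := T) h0 h1 G hl hlb hw₀ hlN hd₁ hd₂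
  have hc3 := mean_exists_false_alarm_le (n := n) (N := N) (Δ := Δ) (thr := thr) hp0 hpq hq1 h0 h1
    (T := T')
  have hcν : deviation q ρ c + atypMass q b G c + (if A c then (1 : ℝ) else 0)
      + (if A' c then (1 : ℝ) else 0) ≤ ν := by
    linarith
  have hdev0 : 0 ≤ deviation q ρ c := sum_nonneg fun z _ =>
    mul_nonneg (noiseP_nonneg hq0.le hq1.le z) (abs_nonneg _)
  have hatyp0 : 0 ≤ atypMass q b G c := by
    refine sum_nonneg fun z _ => mul_nonneg (noiseP_nonneg hq0.le hq1.le z)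
      (codeMean_nonneg c fun x => mul_nonneg (Real.exp_pos _).le (add_nonneg ?_
        (ite_one_zero_nonneg _)))
    split_ifs <;> simp
  have hAc : ¬ A c := by
    intro h
    rw [if_pos h] at hcν
    linarith [ite_one_zero_nonneg (A' c)]
  have hAc' : ¬ A' c := by
    intro h
    rw [if_pos h] at hcν
    linarith [ite_one_zero_nonneg (A c)]
  rw [if_neg hAc, if_neg hAc'] at hcν
  refine ⟨keyedCode p q thr c, ?_, ?_⟩
  · have := Perr_keyedCode_le (thr := thr) (b := b) (T' := T') hp0.le hq0 hq1 c G hT0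
      (fun z s hG hs => not_lt.1 fun h => hAc ⟨z, s, hG, hs, h⟩)
      (fun s hs => not_lt.1 fun h => hAc' ⟨s, hs, h⟩)
    linarith
  · have := covertGap_keyedCode_ge (p := p) (thr := thr) hq0 hq1 (ρ := ρ) c
    linarith

end Existence

end CovertComm

namespace CovertComm

open Finset Filter Topology

section Exponents

variable {p q : ℝ}

/-- The divergence between Bob's two output distributions under the worst-case jamming, in nats. -/
noncomputable def divB (p q : ℝ) : ℝ :=
  theta p q * Real.log (dlr p q true) + (1 - theta p q) * Real.log (dlr p q false)

/-- The divergence between James' two output distributions, in nats. -/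
noncomputable def divJ (q : ℝ) : ℝ := ∑ a, ber q a * (lr q a * Real.log (lr q a))

lemma exists_pos_lt_zero_of_hasDerivAt {f : ℝ → ℝ} {f' : ℝ} (h0 : f 0 = 0)
    (hf : HasDerivAt f f' 0) (hneg : f' < 0) : ∃ κ, 0 < κ ∧ f κ < 0 := by
  have h := hf.tendsto_slope_zero_right
  have h1 : ∀ᶠ x in 𝓝[>] (0 : ℝ), x⁻¹ • (f (0 + x) - f 0) < 0 := h.eventually (gt_mem_nhds hneg)
  obtain ⟨x, hx, hx0⟩ := (h1.and self_mem_nhdsWithin).exists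
  have hx0' : (0 : ℝ) < x := hx0
  refine ⟨x, hx0', ?_⟩
  rw [h0, zero_add, sub_zero, smul_eq_mul] at hx
  by_contra hc
  exact absurd hx (not_lt.2 (mul_nonneg (inv_nonneg.2 hx0'.le) (not_lt.1 hc)))

lemma hasDerivAt_exp_mul_const (r : ℝ) : HasDerivAt (fun κ : ℝ => Real.exp (κ * r)) r 0 := by
  have := ((hasDerivAt_id (0 : ℝ)).mul_const r).exp
  simpa using this

lemma exists_miss_exponent (p q : ℝ) {ε : ℝ} (hε : 0 < ε) :
    ∃ κ, 0 < κ ∧ theta p q * Real.exp (-(κ * Real.log (dlr p q true)))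
      + (1 - theta p q) * Real.exp (-(κ * Real.log (dlr p q false))) - 1
      + κ * (divB p q - ε) < 0 := by
  refine exists_pos_lt_zero_of_hasDerivAt (f := fun κ => theta p q
      * Real.exp (-(κ * Real.log (dlr p q true)))
      + (1 - theta p q) * Real.exp (-(κ * Real.log (dlr p q false))) - 1
      + κ * (divB p q - ε)) (f' := -ε) (by simp) ?_ (by linarith)
  simp_rw [← mul_neg]
  have h := ((((hasDerivAt_exp_mul_const (-Real.log (dlr p q true))).const_mul (theta p q)).add
    ((hasDerivAt_exp_mul_const (-Real.log (dlr p q false))).const_mul (1 - theta p q))).sub_const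
    1).add ((hasDerivAt_id (0 : ℝ)).mul_const (divB p q - ε))
  refine h.congr_deriv ?_
  rw [divB]; ring

lemma exists_large_exponent (hq0 : 0 < q) (hq1 : q < 1) {ε : ℝ} (hε : 0 < ε) :
    ∃ κ, 0 < κ ∧ ∑ a, ber q a * Real.exp ((1 + κ) * Real.log (lr q a)) - 1
      - κ * (divJ q + ε) < 0 := by
  have e : ∀ κ : ℝ, ∀ a, Real.exp ((1 + κ) * Real.log (lr q a))
      = lr q a * Real.exp (κ * Real.log (lr q a)) := by
    intro κ a
    rw [add_mul, one_mul, Real.exp_add, Real.exp_log (lr_pos hq0 hq1 a)]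
  simp_rw [e]
  refine exists_pos_lt_zero_of_hasDerivAt (f := fun κ => ∑ a, ber q a
      * (lr q a * Real.exp (κ * Real.log (lr q a))) - 1 - κ * (divJ q + ε)) (f' := -ε)
      (by simp only [zero_mul, Real.exp_zero, mul_one, sum_ber_mul_lr hq0 hq1]; ring) ?_
      (by linarith)
  have h := ((HasDerivAt.fun_sum (u := univ) fun a _ => ((hasDerivAt_exp_mul_const
    (Real.log (lr q a))).const_mul (lr q a)).const_mul (ber q a)).sub_const 1).sub
    ((hasDerivAt_id (0 : ℝ)).mul_const (divJ q + ε))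
  refine h.congr_deriv ?_
  rw [divJ]; ring

lemma exists_atypical_exponent (hq0 : 0 < q) (hq1 : q < 1) {η : ℝ} (hη : 0 < η) :
    ∃ κ, 0 < κ ∧ ∑ a, ber q a * Real.exp (κ * (lr q a - 1 - η)) < 1 := by
  obtain ⟨κ, hκ, h⟩ := exists_pos_lt_zero_of_hasDerivAt (f := fun κ => ∑ a, ber q a
      * Real.exp (κ * (lr q a - 1 - η)) - 1) (f' := -η)
      (by simp only [zero_mul, Real.exp_zero, mul_one, sum_ber, sub_self])
      (by
        have h := (HasDerivAt.fun_sum (u := univ) fun a _ => (hasDerivAt_exp_mul_const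
          (lr q a - 1 - η)).const_mul (ber q a)).sub_const 1
        refine h.congr_deriv ?_
        simp_rw [mul_sub, sum_sub_distrib, ← sum_mul, sum_ber_mul_lr hq0 hq1, mul_one, sum_ber]
        ring) (by linarith)
  exact ⟨κ, hκ, by linarith⟩

lemma divB_pos (hp0 : 0 < p) (hpq : p < q) (hq1 : q < 1) : 0 < divB p q := by
  obtain ⟨h1, h2⟩ := theta_bounds hp0 hpq hq1
  have h3 := dlr_pos hp0 hpq hq1 true
  have h4 := dlr_pos hp0 hpq hq1 false
  have h5 := one_lt_dlr_true hp0 hpq hq1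
  have h6 : 1 - (dlr p q true)⁻¹ < Real.log (dlr p q true) := by
    have := Real.log_lt_sub_one_of_pos (inv_pos.2 h3) (inv_ne_one.2 h5.ne')
    rw [Real.log_inv] at this; linarith
  have h7 : 1 - (dlr p q false)⁻¹ ≤ Real.log (dlr p q false) :=
    Real.one_sub_inv_le_log_of_pos h4
  have h8 := mul_lt_mul_of_pos_left h6 (by linarith : 0 < theta p q)
  have h9 := mul_le_mul_of_nonneg_left h7 (by linarith : 0 ≤ 1 - theta p q)
  have h10 : theta p q * (1 - (dlr p q true)⁻¹) + (1 - theta p q) * (1 - (dlr p q false)⁻¹) = 0 := by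
    have : theta p q ≠ 0 := by linarith
    have : 1 - theta p q ≠ 0 := by linarith
    simp only [dlr, Bool.false_eq_true, if_true, if_false]
    field_simp; ring
  rw [divB]; linarith

lemma divB_eq (hp0 : 0 < p) (hpq : p < q) (hq1 : q < 1) : divB p q = IB p q * Real.log 2 := by
  have h3 := dlr_pos hp0 hpq hq1 true
  have h4 := dlr_pos hp0 hpq hq1 false
  have hq0 : 0 < q := hp0.trans hpq
  have h1q : 1 - q ≠ 0 := by linarith
  have h1p : 1 - p ≠ 0 := by linarith
  have hl : Real.log 2 ≠ 0 := (Real.log_pos one_lt_two).ne'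
  have e1 : (q - p + p * q) / (p * q) = dlr p q true := by
    simp [dlr, theta]; field_simp; ring
  have e2 : (q - p + p * q) * (1 - p) / (p ^ 2 * (1 - q)) = dlr p q true / dlr p q false := by
    rw [← e1]; simp [dlr, theta]; field_simp
  have e3 : p * (q - 1) / q = -(1 - theta p q) := by
    rw [theta]; field_simp; ring
  rw [IB, e1, e2, e3, Real.logb, Real.logb, Real.log_div h3.ne' h4.ne', divB]
  field_simp; ring

lemma divJ_eq (hq0 : 0 < q) (hq1 : q < 1) : divJ q = IJ q * Real.log 2 := by
  have h1q : 1 - q ≠ 0 := by linarith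
  have hl : Real.log 2 ≠ 0 := (Real.log_pos one_lt_two).ne'
  have e : q / (1 - q) = ((1 - q) / q)⁻¹ := by rw [inv_div]
  rw [IJ, Real.logb, divJ]
  simp [ber, lr]
  rw [e, Real.log_inv]
  field_simp; ring

end Exponents

section Limits

lemma tendsto_sqrt_natCast : Tendsto (fun n : ℕ => Real.sqrt n) atTop atTop :=
  Real.tendsto_sqrt_atTop.comp tendsto_natCast_atTop_atTop

lemma tendsto_exp_neg_sqrt {c : ℝ} (hc : 0 < c) :
    Tendsto (fun n : ℕ => Real.exp (-(Real.sqrt n * c))) atTop (𝓝 0) :=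
  Real.tendsto_exp_neg_atTop_nhds_zero.comp (tendsto_sqrt_natCast.atTop_mul_const hc)

lemma tendsto_exp_linear_sub_exp (A : ℝ) {B g : ℝ} (hB : 0 < B) (hg : 0 < g) :
    Tendsto (fun n : ℕ => Real.exp (n * A - B * Real.exp (Real.sqrt n * g))) atTop (𝓝 0) := by
  refine Real.tendsto_exp_atBot.comp ?_
  have h : Tendsto (fun x : ℝ => x ^ 2 * (B * g ^ 3 / 6 * x + -A)) atTop atTop :=
    (tendsto_pow_atTop two_ne_zero).atTop_mul_atTop₀
      (tendsto_atTop_add_const_right _ _ (tendsto_id.const_mul_atTop (by positivity)))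
  refine tendsto_atBot_mono (fun n => ?_)
    (tendsto_neg_atTop_atBot.comp (h.comp tendsto_sqrt_natCast))
  have hx : 0 ≤ Real.sqrt n := Real.sqrt_nonneg _
  have h1 := Real.pow_div_factorial_le_exp (x := Real.sqrt n * g) (by positivity) 3
  have h2 := mul_le_mul_of_nonneg_left h1 hB.le
  have h3 : (n : ℝ) = Real.sqrt n ^ 2 := (Real.sq_sqrt (Nat.cast_nonneg n)).symm
  simp only [Function.comp]
  rw [show (Nat.factorial 3 : ℝ) = 6 by norm_num [Nat.factorial]] at h2
  have h4 : (n : ℝ) * A = Real.sqrt n ^ 2 * A := by rw [← h3]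
  rw [h4]
  nlinarith

lemma tendsto_pow_mul_exp_sqrt {γ L : ℝ} (h0 : 0 < γ) (h1 : γ < 1) :
    Tendsto (fun n : ℕ => γ ^ n * Real.exp (Real.sqrt n * L)) atTop (𝓝 0) := by
  have hl : 0 < -Real.log γ := by linarith [Real.log_neg h0 h1]
  have h : Tendsto (fun x : ℝ => x * (-Real.log γ * x + -L)) atTop atTop :=
    tendsto_id.atTop_mul_atTop₀
      (tendsto_atTop_add_const_right _ _ (tendsto_id.const_mul_atTop hl))
  refine ((Real.tendsto_exp_neg_atTop_nhds_zero.comp h).comp tendsto_sqrt_natCast).congr fun n => ?_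
  have h3 : (n : ℝ) = Real.sqrt n ^ 2 := (Real.sq_sqrt (Nat.cast_nonneg n)).symm
  simp only [Function.comp]
  rw [← Real.exp_log h0, ← Real.exp_nat_mul, Real.exp_log h0, ← Real.exp_add]
  congr 1
  have h4 : (n : ℝ) * Real.log γ = Real.sqrt n ^ 2 * Real.log γ := by rw [← h3]
  rw [h4]; ring

end Limits

end CovertComm

namespace CovertComm

open Finset Filter Topology

section CodeSequence

variable {p q : ℝ}

lemma meanAtyp_le {n : ℕ} {ρ : ℝ} (hq0 : 0 < q) (hq2 : q < 1 / 2) (h0 : 0 ≤ ρ) (h1 : ρ ≤ 1)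
    {κ₁ κ₂ η b : ℝ} (hκ₁ : 0 ≤ κ₁) (hκ₂ : 0 ≤ κ₂) :
    meanAtyp q ρ b (fun z : BV n => ∑ i, lr q (z i) ≤ (1 + η) * n)
      ≤ Real.exp (n * ρ * (∑ a, ber q a * Real.exp ((1 + κ₁) * Real.log (lr q a)) - 1) - κ₁ * b)
        + (∑ a, ber q a * Real.exp (κ₂ * (lr q a - 1 - η))) ^ n
          * Real.exp (n * ρ * lr q true) := by
  classical
  refine le_trans (le_of_eq ?_) (add_le_add
    (mean_large_jamesLL_le (n := n) hq0 (by linarith) h0 h1 (b := b) hκ₁)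
    (mean_atypical_le (n := n) hq0 hq2 h0 h1 (η := η) hκ₂))
  rw [meanAtyp, ← sum_add_distrib]
  refine sum_congr rfl fun z _ => ?_
  rw [← mul_add, ← sum_add_distrib]
  congr 1
  refine sum_congr rfl fun x _ => ?_
  rcases le_or_gt (∑ i, lr q (z i)) ((1 + η) * n) with h | h
  · rw [if_pos h, if_neg (not_lt.2 h)]; ring
  · rw [if_neg (not_le.2 h), if_pos h]; ring

lemma pow_four_mul_exp_le {n : ℕ} {x y A : ℝ} (h : x ≤ y) (hA : Real.log 4 ≤ A) :
    4 ^ n * Real.exp x ≤ Real.exp (n * A + y) := by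
  rw [Real.exp_add, Real.exp_nat_mul]
  refine mul_le_mul (pow_le_pow_left₀ (by norm_num) ?_ n) (Real.exp_le_exp.2 h)
    (Real.exp_pos _).le (by positivity)
  rw [← Real.exp_log (by norm_num : (0 : ℝ) < 4)]
  exact Real.exp_le_exp.2 hA

set_option maxHeartbeats 2000000 in
lemma exists_codes (hp0 : 0 < p) (hpq : p < q) (hq2 : q < 1 / 2) {t s δ₁ : ℝ} (ht : 0 < t)
    (hs : 0 < s) (hδ : 0 < δ₁) (hR : δ₁ < t * divB p q)
    (hJ : δ₁ < t * divB p q + s - t * divJ q) {Δ : ℕ → ℕ}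
    (hΔ : ∀ᶠ n : ℕ in atTop, Real.sqrt n * s ≤ Δ n * Real.log 2) :
    ∃ ν : ℕ → ℝ, Tendsto ν atTop (𝓝 0) ∧ ∀ᶠ n : ℕ in atTop, ∃ (N : ℕ) (C : Code n N (Δ n)),
      Real.exp (Real.sqrt n * (t * divB p q - δ₁)) ≤ N ∧ Perr p q C ≤ ν n ∧
      ∑ z : BV n, noiseP q z * min 1 (avgLR q (t / Real.sqrt n) z) - ν n ≤ covertGap q C := by
  have hq0 : 0 < q := hp0.trans hpq
  have hq1 : q < 1 := by linarith
  set R := t * divB p q - δ₁ with hRdef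
  set g₀ := t * divB p q + s - t * divJ q - δ₁ with hg₀
  have hg₀' : 0 < g₀ := by rw [hg₀]; linarith
  have hR0 : 0 < R := by rw [hRdef]; linarith
  obtain ⟨κ₁, hκ₁, hf₁⟩ := exists_miss_exponent p q (ε := δ₁ / (4 * t)) (by positivity)
  set f₁ := theta p q * Real.exp (-(κ₁ * Real.log (dlr p q true)))
      + (1 - theta p q) * Real.exp (-(κ₁ * Real.log (dlr p q false))) - 1
      + κ₁ * (divB p q - δ₁ / (4 * t)) with hf₁def
  obtain ⟨κ₂, hκ₂, hf₂⟩ := exists_large_exponent hq0 hq1 (ε := g₀ / (4 * t)) (by positivity)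
  set f₂ := ∑ a, ber q a * Real.exp ((1 + κ₂) * Real.log (lr q a)) - 1
      - κ₂ * (divJ q + g₀ / (4 * t)) with hf₂def
  set η := min (-f₁ / 2) (min (δ₁ / (8 * t)) (s / (4 * t))) with hη
  have hη0 : 0 < η := lt_min (by linarith) (lt_min (by positivity) (by positivity))
  have hη1 : η ≤ -f₁ / 2 := min_le_left _ _
  have hη2 : t * η ≤ δ₁ / 8 := by
    have : η ≤ δ₁ / (8 * t) := (min_le_right _ _).trans (min_le_left _ _)
    calc t * η ≤ t * (δ₁ / (8 * t)) := mul_le_mul_of_nonneg_left this ht.le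
      _ = δ₁ / 8 := by field_simp
  have hη3 : t * η ≤ s / 4 := by
    have : η ≤ s / (4 * t) := (min_le_right _ _).trans (min_le_right _ _)
    calc t * η ≤ t * (s / (4 * t)) := mul_le_mul_of_nonneg_left this ht.le
      _ = s / 4 := by field_simp
  obtain ⟨κ₃, hκ₃, hγ1⟩ := exists_atypical_exponent hq0 hq1 hη0
  set γ := ∑ a, ber q a * Real.exp (κ₃ * (lr q a - 1 - η)) with hγ
  have hγ0 : 0 < γ := by
    have h1 : 0 < 1 - q := by linarith
    simp only [hγ, Fintype.sum_bool, ber, if_true, Bool.false_eq_true, if_false]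
    positivity
  set c₄ := min (t * (-f₁) / 2) (δ₁ / 2) with hc₄
  have hc₄0 : 0 < c₄ := lt_min (by nlinarith) (by linarith)
  have hc₄1 : c₄ ≤ t * (-f₁) / 2 := min_le_left _ _
  have hc₄2 : c₄ ≤ δ₁ / 2 := min_le_right _ _
  set c₃ := min (c₄ / 2) (min (g₀ / 4) (s / 4)) with hc₃
  have hc₃0 : 0 < c₃ := lt_min (by linarith) (lt_min (by linarith) (by linarith))
  have hc₃1 : c₃ ≤ c₄ / 2 := min_le_left _ _
  have hc₃2 : c₃ ≤ g₀ / 4 := (min_le_right _ _).trans (min_le_left _ _)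
  have hc₃3 : c₃ ≤ s / 4 := (min_le_right _ _).trans (min_le_right _ _)
  set ℓ := max (t * divJ q + g₀ / 4) (R + t * η) with hℓ
  have hℓ1 : t * divJ q + g₀ / 4 ≤ ℓ := le_max_left _ _
  have hℓ2 : R + t * η ≤ ℓ := le_max_right _ _
  set g := R + s - ℓ - c₃ with hg
  have hg0 : 0 < g := by
    have : ℓ < R + s - c₃ := max_lt (by linarith) (by linarith)
    linarith
  set L := t * lr q true with hL
  set ν : ℕ → ℝ := fun n => Real.exp (-(Real.sqrt n * (g₀ / 4)))
    + 3 * (Real.exp (-(Real.sqrt n * (t * (-f₂)))) + γ ^ n * Real.exp (Real.sqrt n * L))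
    + Real.exp (n * Real.log 4 - 1 / 4 * Real.exp (Real.sqrt n * g))
    + Real.exp (n * Real.log 4 - 1 / 2 * Real.exp (Real.sqrt n * (s - c₃)))
    + 2 * Real.exp (-(Real.sqrt n * c₃)) with hν
  have hνlim : Tendsto ν atTop (𝓝 0) := by
    have h := ((((tendsto_exp_neg_sqrt (by linarith : 0 < g₀ / 4)).add
      (((tendsto_exp_neg_sqrt (mul_pos ht (by linarith) : 0 < t * (-f₂))).add
      (tendsto_pow_mul_exp_sqrt (L := L) hγ0 hγ1)).const_mul 3)).add
      (tendsto_exp_linear_sub_exp (Real.log 4) (by norm_num : (0 : ℝ) < 1 / 4) hg0)).add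
      (tendsto_exp_linear_sub_exp (Real.log 4) (by norm_num : (0 : ℝ) < 1 / 2)
        (by linarith : 0 < s - c₃))).add ((tendsto_exp_neg_sqrt hc₃0).const_mul 2)
    simp only [mul_zero, add_zero] at h
    exact h
  refine ⟨ν, hνlim, ?_⟩
  have hev1 : ∀ᶠ n : ℕ in atTop, max 1 t ≤ Real.sqrt n :=
    tendsto_sqrt_natCast.eventually_ge_atTop _
  have hev2 : ∀ᶠ n : ℕ in atTop,
      (1 + η) * Real.exp (t / Real.sqrt n * dlr p q true) < 1 + 2 * η := by
    have h1 : Tendsto (fun n : ℕ => t / Real.sqrt n * dlr p q true) atTop (𝓝 0) := by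
      simpa using (tendsto_sqrt_natCast.const_div_atTop t).mul_const (dlr p q true)
    have h2 : Tendsto (fun n : ℕ => (1 + η) * Real.exp (t / Real.sqrt n * dlr p q true)) atTop
        (𝓝 ((1 + η) * Real.exp 0)) := ((Real.continuous_exp.tendsto 0).comp h1).const_mul _
    rw [Real.exp_zero, mul_one] at h2
    exact h2.eventually (gt_mem_nhds (by linarith))
  have hev3 : ∀ᶠ n : ℕ in atTop,
      Real.exp 4 * 3 * Real.exp (-(Real.sqrt n * (c₄ / 2))) < 1 / 2 := by
    have h := (tendsto_exp_neg_sqrt (by linarith : 0 < c₄ / 2)).const_mul (Real.exp 4 * 3)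
    rw [mul_zero] at h
    exact h.eventually (gt_mem_nhds (by norm_num))
  have hev4 : ∀ᶠ n : ℕ in atTop, ν n < 1 := hνlim.eventually (gt_mem_nhds one_pos)
  filter_upwards [hev1, hev2, hev3, hev4, hΔ] with n h₁ h₂ h₃ h₄ hΔn
  set a := Real.sqrt n with ha
  have ha1 : 1 ≤ a := (le_max_left _ _).trans h₁
  have hat : t ≤ a := (le_max_right _ _).trans h₁
  have ha0 : 0 < a := by linarith
  have hna : (n : ℝ) = a * a := (Real.mul_self_sqrt (Nat.cast_nonneg n)).symm
  set ρ := t / a with hρ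
  have hρ0 : 0 ≤ ρ := by positivity
  have hρ1 : ρ ≤ 1 := (div_le_one ha0).2 hat
  have hnρ : n * ρ = a * t := by rw [hna, hρ]; field_simp
  set N := ⌈Real.exp (a * R)⌉₊ with hN
  have hN1 : Real.exp (a * R) ≤ N := Nat.le_ceil _
  have hN2 : (N : ℝ) ≤ 2 * Real.exp (a * R) := by
    have h5 := (Nat.ceil_lt_add_one (Real.exp_pos (a * R)).le).le
    have h6 : 1 ≤ Real.exp (a * R) := Real.one_le_exp (by positivity)
    linarith
  have hN0 : 0 < N := Nat.ceil_pos.2 (Real.exp_pos _)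
  have hNr : (0 : ℝ) < N := Nat.cast_pos.2 hN0
  have hK : Real.exp (a * s) ≤ 2 ^ Δ n := by
    rw [← Real.exp_log (by positivity : (0 : ℝ) < 2 ^ Δ n), Real.log_pow]
    exact Real.exp_le_exp.2 hΔn
  have hK0 : (0 : ℝ) < 2 ^ Δ n := by positivity
  have hM : Real.exp (a * (R + s)) ≤ N * 2 ^ Δ n := by
    rw [mul_add, Real.exp_add]
    exact mul_le_mul hN1 hK (Real.exp_pos _).le hNr.le
  set G : BV n → Prop := fun z => ∑ i, lr q (z i) ≤ (1 + η) * n with hG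
  set b := a * (t * divJ q + g₀ / 4) with hb
  set thr := a * (t * (divB p q - δ₁ / (4 * t))) with hthr
  have hthr' : thr = a * (R + 3 * δ₁ / 4) := by rw [hthr, hRdef]; field_simp; ring
  set τ := Real.exp (-(a * c₃)) with hτ
  set lam := 1 / 2 * Real.exp (-(a * ℓ)) with hlam
  have hlam0 : 0 < lam := by positivity
  have hτ0 : 0 < τ := Real.exp_pos _
  have hatyp : meanAtyp q ρ b G ≤ Real.exp (-(a * (t * (-f₂)))) + γ ^ n * Real.exp (a * L) := by
    refine (meanAtyp_le hq0 hq2 hρ0 hρ1 hκ₂.le hκ₃.le).trans (le_of_eq ?_)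
    rw [hnρ]
    congr 3
    · rw [hf₂def, hb]; field_simp
    · rw [hL]; ring
  have hd₁ : ∀ z s' : BV n, G z → (wt s' : ℝ) ≤ p * n → ∑ x : BV n, noiseP ρ x *
      (Real.exp (jamesLL q z x) * (if score p q x (vxor x s') < thr then 1 else 0))
      ≤ Real.exp (-(a * c₄)) := by
    intro z s' hz hs'
    have h := mean_miss_le hp0 hpq hq2 hρ0 hρ1 hη0.le hκ₁.le (thr := thr) hz hs'
    classical
    refine le_trans (le_of_eq ?_) (h.trans (Real.exp_le_exp.2 ?_))
    · exact sum_congr rfl fun x _ => by congr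
    · rw [hnρ]
      have e : a * t * (theta p q * Real.exp (-(κ₁ * Real.log (dlr p q true)))
          + (1 - theta p q) * Real.exp (-(κ₁ * Real.log (dlr p q false))) - 1 + η) + κ₁ * thr
          = a * (t * (f₁ + η)) := by rw [hthr, hf₁def]; ring
      rw [e, ← mul_neg]
      refine mul_le_mul_of_nonneg_left ?_ ha0.le
      have := mul_le_mul_of_nonneg_left hη1 ht.le
      linarith
  have hd₂ : ∀ z s' : BV n, G z → (wt s' : ℝ) ≤ p * n →
      ∑ x : BV n, ∑ x' : BV n, noiseP ρ x * noiseP ρ x' * (Real.exp (jamesLL q z x)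
        * (if thr ≤ score p q x' (vxor x s') then 1 else 0))
      ≤ Real.exp (-(a * (R + δ₁ / 2))) := by
    intro z s' hz hs'
    have h := mean_conf_le hp0 hpq hq2 hρ0 hρ1 (thr := thr) hz hs'
    classical
    refine le_trans (le_of_eq ?_) (h.trans (Real.exp_le_exp.2 ?_))
    · exact sum_congr rfl fun x _ => sum_congr rfl fun x' _ => by congr
    · rw [hnρ, hthr']
      have h5 : a * t * ((1 + η) * Real.exp (ρ * dlr p q true) - 1) ≤ a * t * (2 * η) :=
        mul_le_mul_of_nonneg_left (by linarith) (by positivity)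
      have h6 := mul_le_mul_of_nonneg_left hη2 ha0.le
      linarith
  have hd : Real.exp 4 * (Real.exp (-(a * c₄)) + N * Real.exp (-(a * (R + δ₁ / 2)))) ≤ τ / 2 := by
    have h5 : N * Real.exp (-(a * (R + δ₁ / 2))) ≤ 2 * Real.exp (-(a * c₄)) := by
      refine (mul_le_mul_of_nonneg_right hN2 (Real.exp_pos _).le).trans ?_
      rw [mul_assoc, ← Real.exp_add]
      refine mul_le_mul_of_nonneg_left (Real.exp_le_exp.2 ?_) zero_le_two
      have := mul_le_mul_of_nonneg_left hc₄2 ha0.le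
      linarith
    have h6 : Real.exp (-(a * c₄)) ≤ Real.exp (-(a * (c₄ / 2))) * τ := by
      rw [hτ, ← Real.exp_add]
      refine Real.exp_le_exp.2 ?_
      have := mul_le_mul_of_nonneg_left hc₃1 ha0.le
      linarith
    have h7 : Real.exp 4 * (Real.exp (-(a * c₄)) + N * Real.exp (-(a * (R + δ₁ / 2))))
        ≤ Real.exp 4 * (3 * (Real.exp (-(a * (c₄ / 2))) * τ)) :=
      mul_le_mul_of_nonneg_left (by linarith) (Real.exp_pos _).le
    have h8 := mul_le_mul_of_nonneg_right h₃.le hτ0.le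
    linarith
  have hu₁ : 4 ^ n * Real.exp (2 ^ Δ n * (Real.exp 4 * (lam * N * (Real.exp (-(a * c₄))
        + N * Real.exp (-(a * (R + δ₁ / 2)))))) - lam * (N * 2 ^ Δ n * τ))
      ≤ Real.exp (n * Real.log 4 - 1 / 4 * Real.exp (a * g)) := by
    rw [sub_eq_add_neg (n * Real.log 4)]
    refine pow_four_mul_exp_le ?_ le_rfl
    have h5 := mul_le_mul_of_nonneg_left hd (by positivity : 0 ≤ lam * (N * 2 ^ Δ n))
    have h6 : 1 / 2 * Real.exp (a * g) ≤ lam * (N * 2 ^ Δ n) * τ := by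
      have e : Real.exp (a * g) = Real.exp (-(a * ℓ)) * Real.exp (a * (R + s)) * τ := by
        rw [hτ, ← Real.exp_add, ← Real.exp_add, hg]; congr 1; ring
      rw [e, hlam]
      have := mul_le_mul_of_nonneg_left hM (by positivity : 0 ≤ 1 / 2 * Real.exp (-(a * ℓ)) * τ)
      linarith
    linarith
  have hu₂ : 2 ^ n * Real.exp (2 ^ Δ n * (2 * (N * Real.exp (-thr))) - 2 ^ Δ n * τ)
      ≤ Real.exp (n * Real.log 4 - 1 / 2 * Real.exp (a * (s - c₃))) := by
    rw [sub_eq_add_neg (n * Real.log 4)]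
    refine le_trans (mul_le_mul_of_nonneg_right (pow_le_pow_left₀ zero_le_two
      (by norm_num : (2 : ℝ) ≤ 4) n) (Real.exp_pos _).le) (pow_four_mul_exp_le ?_ le_rfl)
    have h5 : N * Real.exp (-thr) ≤ 2 * (Real.exp (-(a * (c₄ / 2))) * τ) := by
      refine (mul_le_mul_of_nonneg_right hN2 (Real.exp_pos _).le).trans ?_
      rw [mul_assoc, hτ, ← Real.exp_add, ← Real.exp_add, hthr']
      refine mul_le_mul_of_nonneg_left (Real.exp_le_exp.2 ?_) zero_le_two
      have h6 := mul_le_mul_of_nonneg_left hc₃1 ha0.le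
      have h7 := mul_le_mul_of_nonneg_left hc₄2 ha0.le
      have h8 := mul_pos ha0 hδ
      linarith
    have h6 : 2 * (N * Real.exp (-thr)) ≤ τ / 2 := by
      have h7 := mul_le_mul_of_nonneg_right h₃.le hτ0.le
      have h8 : 5 ≤ Real.exp 4 := by linarith [Real.add_one_le_exp (4 : ℝ)]
      have h9 := mul_le_mul_of_nonneg_right h8
        (by positivity : 0 ≤ Real.exp (-(a * (c₄ / 2))) * τ)
      have h10 : 0 ≤ Real.exp (-(a * (c₄ / 2))) * τ := by positivity
      linarith
    have h7 := mul_le_mul_of_nonneg_left h6 hK0.le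
    have h8 : Real.exp (a * (s - c₃)) ≤ 2 ^ Δ n * τ := by
      rw [mul_sub, sub_eq_add_neg, Real.exp_add]
      exact mul_le_mul_of_nonneg_right hK hτ0.le
    linarith
  obtain ⟨C, hC1, hC2⟩ := exists_code (p := p) (q := q) (ρ := ρ) (thr := thr) (b := b) (N := N)
    (Δ := Δ n) hp0 hpq hq1 hρ0 hρ1 hN0 G (lam := lam) (w₀ := Real.exp (a * (t * η)))
    (d₁ := Real.exp (-(a * c₄))) (d₂ := Real.exp (-(a * (R + δ₁ / 2))))
    (T := N * 2 ^ Δ n * τ) (T' := 2 ^ Δ n * τ) (r := Real.exp (-(a * (g₀ / 4))))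
    (ν := ν n - 2 * τ) (by positivity) (Real.exp_pos _)
    (by
      refine le_trans ?_ (mul_le_mul_of_nonneg_left hM (by positivity))
      rw [← Real.exp_nat_mul, ← Real.exp_add]
      refine Real.exp_le_exp.2 ?_
      rw [hb, Nat.cast_ofNat]
      have h5 := mul_pos ha0 hg₀'
      have h6 : a * (R + s) = a * (g₀ + t * divJ q) := by rw [hg₀, hRdef]; ring
      rw [h6]; linarith)
    hlam0.le
    (by
      rw [hlam, mul_assoc, ← Real.exp_add]
      have : Real.exp (-(a * ℓ) + b) ≤ 1 := by
        rw [Real.exp_le_one_iff, hb]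
        have := mul_le_mul_of_nonneg_left hℓ1 ha0.le
        linarith
      linarith)
    (fun z hz => by
      refine (mean_jamesLL_le hq0 hq1 hρ0 hρ1 hz).trans (le_of_eq ?_)
      rw [hnρ, mul_assoc])
    (by
      have h5 : lam * N ≤ lam * (2 * Real.exp (a * R)) := mul_le_mul_of_nonneg_left hN2 hlam0.le
      refine (mul_le_mul_of_nonneg_right h5 (Real.exp_pos _).le).trans ?_
      have e : lam * (2 * Real.exp (a * R)) * Real.exp (a * (t * η))
          = Real.exp (-(a * ℓ) + a * R + a * (t * η)) := by
        rw [hlam, Real.exp_add, Real.exp_add]; ring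
      rw [e, Real.exp_le_one_iff]
      have := mul_le_mul_of_nonneg_left hℓ2 ha0.le
      linarith)
    hd₁ hd₂
    (by
      simp only [hν]
      linarith)
    (by linarith)
  refine ⟨N, C, hN1, hC1.trans (le_of_eq ?_), le_trans (by linarith) hC2⟩
  have e1 : 2 ^ Δ n * τ / 2 ^ Δ n = τ := by field_simp
  have e2 : N * 2 ^ Δ n * τ / (N * 2 ^ Δ n) = τ := by field_simp
  rw [e1, e2]; ring

end CodeSequence

end CovertComm

namespace CovertComm

open Finset Filter Topology MeasureTheory ProbabilityTheory

section DiscreteLaw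

variable {ι : Type*} [Fintype ι] {w : ι → ℝ}

/-- The law of `g` under the finitely supported weights `w`. -/
noncomputable def discreteLaw (w g : ι → ℝ) : Measure ℝ :=
  ∑ i, ENNReal.ofReal (w i) • Measure.dirac (g i)

lemma integral_discreteLaw {E : Type*} [NormedAddCommGroup E] [NormedSpace ℝ E] [CompleteSpace E]
    (hw : ∀ i, 0 ≤ w i) (g : ι → ℝ) (f : ℝ → E) :
    ∫ x, f x ∂discreteLaw w g = ∑ i, w i • f (g i) := by
  rw [discreteLaw, integral_finsetSum_measure]
  · simp [hw]
  · exact fun i _ => (integrable_dirac (by simp)).smul_measure (by simp)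

lemma isProbabilityMeasure_discreteLaw (hw : ∀ i, 0 ≤ w i) (h1 : ∑ i, w i = 1) (g : ι → ℝ) :
    IsProbabilityMeasure (discreteLaw w g) := by
  refine ⟨?_⟩
  simp only [discreteLaw, Measure.coe_finsetSum, Measure.coe_smul, Finset.sum_apply, Pi.smul_apply,
    measure_univ, smul_eq_mul, mul_one]
  rw [← ENNReal.ofReal_sum_of_nonneg fun i _ => hw i, h1, ENNReal.ofReal_one]

end DiscreteLaw

section CentralLimit

variable {q : ℝ} {u : Bool → ℝ}

/-- The normalised sum of the statistic `u` over the bits of `z`. -/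
noncomputable def normSum {n : ℕ} (u : Bool → ℝ) (z : BV n) : ℝ := (√n)⁻¹ * ∑ i, u (z i)

lemma charFun_normSum (hq0 : 0 ≤ q) (hq1 : q ≤ 1) (n : ℕ) (s : ℝ) :
    charFun (discreteLaw (noiseP q) (normSum u : BV n → ℝ)) s
      = charFun (discreteLaw (ber q) u) ((√n)⁻¹ * s) ^ n := by
  rw [charFun_apply_real, charFun_apply_real, integral_discreteLaw (noiseP_nonneg hq0 hq1),
    integral_discreteLaw (ber_nonneg hq0 hq1)]
  have h := Fintype.prod_sum fun (_ : Fin n) (b : Bool) =>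
    ber q b • Complex.exp (↑((√n)⁻¹ * s) * ↑(u b) * Complex.I)
  rw [prod_const, card_univ, Fintype.card_fin] at h
  rw [h]
  refine sum_congr rfl fun z _ => ?_
  simp only [Complex.real_smul]
  rw [prod_mul_distrib, ← Complex.exp_sum, ← Complex.ofReal_prod]
  congr 2
  rw [normSum]
  push_cast
  rw [mul_sum, mul_sum, sum_mul]
  exact sum_congr rfl fun i _ => by ring

lemma tendsto_mean_normSum (hq0 : 0 ≤ q) (hq1 : q ≤ 1) (hu0 : ∑ b, ber q b * u b = 0)
    (hu1 : ∑ b, ber q b * u b ^ 2 = 1) (f : BoundedContinuousFunction ℝ ℝ) :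
    Tendsto (fun n : ℕ => ∑ z : BV n, noiseP q z * f (normSum u z)) atTop
      (𝓝 (∫ x, f x ∂gaussianReal 0 1)) := by
  have hP := isProbabilityMeasure_discreteLaw (ber_nonneg hq0 hq1) (sum_ber q) u
  have hPn : ∀ n : ℕ, IsProbabilityMeasure (discreteLaw (noiseP q) (normSum u : BV n → ℝ)) :=
    fun n => isProbabilityMeasure_discreteLaw (noiseP_nonneg hq0 hq1) (sum_noiseP q) _
  let G : ProbabilityMeasure ℝ := ⟨gaussianReal 0 1, inferInstance⟩
  let P : ℕ → ProbabilityMeasure ℝ := fun n => ⟨discreteLaw (noiseP q) (normSum u : BV n → ℝ), hPn n⟩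
  have key : Tendsto P atTop (𝓝 G) := by
    refine ProbabilityMeasure.tendsto_iff_tendsto_charFun.2 fun s => ?_
    have h := tendsto_charFun_inv_sqrt_mul_pow (P := discreteLaw (ber q) u) (X := id)
      aemeasurable_id
      (by simpa [integral_discreteLaw (ber_nonneg hq0 hq1)] using hu0)
      (by simpa [integral_discreteLaw (ber_nonneg hq0 hq1)] using hu1) s
    simpa [P, G, charFun_normSum hq0 hq1, charFun_gaussianReal, neg_div] using h
  have h := ProbabilityMeasure.tendsto_iff_forall_integral_tendsto.1 key f
  simpa [P, G, integral_discreteLaw (noiseP_nonneg hq0 hq1)] using h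

lemma mean_normSum_sq_le (hu0 : ∑ b, ber q b * u b = 0)
    (hu1 : ∑ b, ber q b * u b ^ 2 = 1) (n : ℕ) :
    ∑ z : BV n, noiseP q z * normSum u z ^ 2 ≤ 1 := by
  have h : ∀ z : BV n, noiseP q z * normSum u z ^ 2
      = (n : ℝ)⁻¹ * (prodWeight (ber q) z * (∑ i, u (z i)) ^ 2) := by
    intro z
    rw [normSum, mul_pow, inv_pow, Real.sq_sqrt (Nat.cast_nonneg n), noiseP_eq_prodWeight]
    ring
  rw [sum_congr rfl fun z _ => h z, ← mul_sum, mean_sum_sq (sum_ber q) hu0, hu1, mul_one,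
    Fintype.card_fin]
  exact inv_mul_le_one

/-- The function `x ↦ min 1 (exp x)` as a bounded continuous function. -/
noncomputable def minOneExp : BoundedContinuousFunction ℝ ℝ :=
  .ofNormedAddCommGroup (fun x => min 1 (Real.exp x)) (by fun_prop) 1 fun x => by
    rw [Real.norm_of_nonneg (le_min zero_le_one (Real.exp_pos x).le)]
    exact min_le_left _ _

lemma abs_min_one_exp_sub_le (x y : ℝ) : |min 1 (Real.exp x) - min 1 (Real.exp y)| ≤ |x - y| := by
  wlog h : y ≤ x generalizing x y
  · rw [abs_sub_comm, abs_sub_comm x]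
    exact this y x (le_of_not_ge h)
  have hxy := Real.exp_le_exp.2 h
  rw [abs_of_nonneg (sub_nonneg.2 (min_le_min_left 1 hxy)), abs_of_nonneg (sub_nonneg.2 h)]
  rcases le_total 1 (Real.exp y) with h1 | h1
  · rw [min_eq_left h1, min_eq_left (h1.trans hxy)]; linarith
  rw [min_eq_right h1]
  have hy : y ≤ 0 := by rwa [Real.exp_le_one_iff] at h1
  rcases le_total x 0 with hx | hx
  · have h2 := Real.add_one_le_exp (y - x)
    have h3 : Real.exp y = Real.exp x * Real.exp (y - x) := by rw [← Real.exp_add]; congr 1; ring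
    have h4 : Real.exp x ≤ 1 := Real.exp_le_one_iff.2 hx
    have := min_le_right 1 (Real.exp x)
    nlinarith [Real.exp_pos x]
  · have := min_le_left 1 (Real.exp x)
    linarith [Real.add_one_le_exp y]

lemma tendsto_mean_min_exp_affine (hq0 : 0 ≤ q) (hq1 : q ≤ 1) (hu0 : ∑ b, ber q b * u b = 0)
    (hu1 : ∑ b, ber q b * u b ^ 2 = 1) {x y : ℕ → ℝ} {x₀ y₀ : ℝ} (hx : Tendsto x atTop (𝓝 x₀))
    (hy : Tendsto y atTop (𝓝 y₀)) :
    Tendsto (fun n : ℕ => ∑ z : BV n, noiseP q z * min 1 (Real.exp (x n + y n * normSum u z)))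
      atTop (𝓝 (∫ g, min 1 (Real.exp (x₀ + y₀ * g)) ∂gaussianReal 0 1)) := by
  have h := tendsto_mean_normSum hq0 hq1 hu0 hu1
    (minOneExp.compContinuous ⟨fun g => x₀ + y₀ * g, by fun_prop⟩)
  have hd : Tendsto (fun n : ℕ => ∑ z : BV n, noiseP q z * (min 1 (Real.exp (x n + y n *
      normSum u z)) - min 1 (Real.exp (x₀ + y₀ * normSum u z)))) atTop (𝓝 0) := by
    have h0 : Tendsto (fun n => |x n - x₀| + 2 * |y n - y₀|) atTop (𝓝 0) := by
      have h1 := (hx.sub_const x₀).abs.add ((hy.sub_const y₀).abs.const_mul 2)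
      simpa using h1
    refine squeeze_zero_norm (fun n => ?_) h0
    refine (norm_sum_le _ _).trans ?_
    have hz : ∀ z : BV n, ‖noiseP q z * (min 1 (Real.exp (x n + y n * normSum u z))
        - min 1 (Real.exp (x₀ + y₀ * normSum u z)))‖
        ≤ noiseP q z * (|x n - x₀| + |y n - y₀|) + noiseP q z * normSum u z ^ 2 * |y n - y₀| := by
      intro z
      rw [norm_mul, Real.norm_of_nonneg (noiseP_nonneg hq0 hq1 z), mul_assoc, ← mul_add]
      refine mul_le_mul_of_nonneg_left ?_ (noiseP_nonneg hq0 hq1 z)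
      refine (abs_min_one_exp_sub_le _ _).trans ?_
      have e : x n + y n * normSum u z - (x₀ + y₀ * normSum u z)
          = (x n - x₀) + (y n - y₀) * normSum u z := by ring
      rw [e]
      refine (abs_add_le _ _).trans ?_
      rw [abs_mul]
      have h2 : |normSum u z| ≤ 1 + normSum u z ^ 2 := by
        rw [← sq_abs]; nlinarith [sq_nonneg (|normSum u z| - 1)]
      nlinarith [mul_le_mul_of_nonneg_left h2 (abs_nonneg (y n - y₀))]
    refine (sum_le_sum fun z _ => hz z).trans ?_
    rw [sum_add_distrib, ← sum_mul, ← sum_mul, sum_noiseP]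
    have := mul_le_mul_of_nonneg_right (mean_normSum_sq_le hu0 hu1 n)
      (abs_nonneg (y n - y₀))
    linarith
  have h3 := h.add hd
  rw [add_zero] at h3
  refine h3.congr fun n => ?_
  rw [← sum_add_distrib]
  refine sum_congr rfl fun z _ => ?_
  simp only [BoundedContinuousFunction.compContinuous_apply, ContinuousMap.coe_mk, minOneExp,
    BoundedContinuousFunction.coe_ofNormedAddCommGroup]
  ring

end CentralLimit

section Gaussian

lemma integral_min_exp_gaussian {μ : ℝ} (hμ : 0 < μ) :
    ∫ g, min 1 (Real.exp (-(μ ^ 2 / 2) + μ * g)) ∂gaussianReal 0 1 = 2 * Qfun (μ / 2) := by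
  rw [integral_gaussianReal_eq_integral_smul one_ne_zero]
  set φ : ℝ → ℝ := fun u => Real.exp (-u ^ 2 / 2) / √(2 * Real.pi) with hφ
  have hpdf : ∀ g, gaussianPDFReal 0 1 g = φ g := by
    intro g
    simp [gaussianPDFReal, hφ, div_eq_inv_mul]
  have hφi : Integrable φ := by
    simpa [funext hpdf] using integrable_gaussianPDFReal 0 1
  have hshift : ∀ g, φ g * Real.exp (-(μ ^ 2 / 2) + μ * g) = φ (μ - g) := by
    intro g
    simp only [hφ]
    rw [div_mul_eq_mul_div, ← Real.exp_add]
    congr 2; ring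
  have hsi : Integrable fun g => φ (μ - g) := hφi.comp_sub_left μ
  have h1 : ∀ g ∈ Set.Ioi (μ / 2), gaussianPDFReal 0 1 g •
      min 1 (Real.exp (-(μ ^ 2 / 2) + μ * g)) = φ g := by
    intro g hg
    rw [Set.mem_Ioi] at hg
    rw [hpdf, min_eq_left (Real.one_le_exp (by nlinarith)), smul_eq_mul, mul_one]
  have h2 : ∀ g ∈ Set.Iic (μ / 2), gaussianPDFReal 0 1 g •
      min 1 (Real.exp (-(μ ^ 2 / 2) + μ * g)) = φ (μ - g) := by
    intro g hg
    rw [Set.mem_Iic] at hg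
    rw [hpdf, min_eq_right (Real.exp_le_one_iff.2 (by nlinarith)), smul_eq_mul, hshift]
  have hi1 : IntegrableOn (fun g => gaussianPDFReal 0 1 g •
      min 1 (Real.exp (-(μ ^ 2 / 2) + μ * g))) (Set.Ioi (μ / 2)) :=
    hφi.integrableOn.congr_fun (fun g hg => (h1 g hg).symm) measurableSet_Ioi
  have hi2 : IntegrableOn (fun g => gaussianPDFReal 0 1 g •
      min 1 (Real.exp (-(μ ^ 2 / 2) + μ * g))) (Set.Iic (μ / 2)) :=
    hsi.integrableOn.congr_fun (fun g hg => (h2 g hg).symm) measurableSet_Iic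
  rw [← intervalIntegral.integral_Iic_add_Ioi hi2 hi1, setIntegral_congr_fun measurableSet_Ioi h1,
    setIntegral_congr_fun measurableSet_Iic h2]
  have h3 : ∫ g in Set.Iic (μ / 2), φ (μ - g) = ∫ g in Set.Ioi (μ / 2), φ g := by
    have e := (Measure.measurePreserving_sub_left volume μ).setIntegral_preimage_emb
      (MeasurableEquiv.subLeft μ).measurableEmbedding φ (Set.Ici (μ / 2))
    rw [integral_Ici_eq_integral_Ioi] at e
    rw [← e]
    congr 2
    ext g
    simp only [Set.mem_Iic, Set.mem_preimage, Set.mem_Ici]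
    constructor <;> intro h <;> linarith
  rw [h3, Qfun]
  ring

lemma integrable_Qfun_integrand : Integrable fun u : ℝ => Real.exp (-u ^ 2 / 2) / √(2 * Real.pi) := by
  refine Integrable.div_const ?_ _
  refine (integrable_exp_neg_mul_sq (by norm_num : (0 : ℝ) < 1 / 2)).congr (ae_of_all _ fun u => ?_)
  simp only
  congr 1; ring

lemma Qfun_zero : Qfun 0 = 1 / 2 := by
  rw [Qfun, integral_div]
  have h : ∀ u : ℝ, Real.exp (-u ^ 2 / 2) = Real.exp (-(1 / 2) * u ^ 2) := fun u => by
    congr 1; ring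
  simp_rw [h]
  rw [integral_gaussian_Ioi]
  have : √(Real.pi / (1 / 2)) = √(2 * Real.pi) := by congr 1; ring
  rw [this]
  have : √(2 * Real.pi) ≠ 0 := by positivity
  field_simp

lemma Qfun_eq (x : ℝ) :
    Qfun x = 1 / 2 - ∫ u in (0 : ℝ)..x, Real.exp (-u ^ 2 / 2) / √(2 * Real.pi) := by
  have h := intervalIntegral.integral_interval_add_Ioi
    (integrable_Qfun_integrand.integrableOn (s := Set.Ioi 0))
    (integrable_Qfun_integrand.integrableOn (s := Set.Ioi x))
  rw [← Qfun_zero, Qfun, Qfun]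
  linarith

lemma continuous_Qfun : Continuous Qfun := by
  rw [funext Qfun_eq]
  exact continuous_const.sub (intervalIntegral.continuous_primitive
    (fun a b => integrable_Qfun_integrand.intervalIntegrable) 0)

lemma tendsto_Qfun : Tendsto Qfun atTop (𝓝 0) := by
  have h := intervalIntegral_tendsto_integral_Ioi 0
    (integrable_Qfun_integrand.integrableOn (s := Set.Ioi 0)) tendsto_id
  have h2 := h.const_sub (1 / 2)
  have h3 : (1 / 2 : ℝ) - ∫ u in Set.Ioi (0 : ℝ), Real.exp (-u ^ 2 / 2) / √(2 * Real.pi) = 0 := by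
    have := Qfun_zero
    rw [Qfun] at this
    linarith
  rw [h3] at h2
  exact h2.congr fun x => (Qfun_eq x).symm

lemma half_le_Qfun {x : ℝ} (hx : x ≤ 0) : 1 / 2 ≤ Qfun x := by
  rw [Qfun_eq, intervalIntegral.integral_symm]
  have := intervalIntegral.integral_nonneg hx
    (f := fun u : ℝ => Real.exp (-u ^ 2 / 2) / √(2 * Real.pi)) (μ := volume)
    fun u _ => by positivity
  linarith

lemma Qfun_Qinv {y : ℝ} (h0 : 0 < y) (h1 : y < 1 / 2) : Qfun (Qinv y) = y := by
  refine Function.invFun_eq ?_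
  obtain ⟨b, hb0, hb⟩ := ((eventually_ge_atTop (0 : ℝ)).and
    (tendsto_Qfun.eventually (gt_mem_nhds h0))).exists
  obtain ⟨x, -, hx⟩ := intermediate_value_Icc' hb0 continuous_Qfun.continuousOn
    ⟨hb.le, by rw [Qfun_zero]; exact h1.le⟩
  exact ⟨x, hx⟩

lemma Qinv_pos {y : ℝ} (h0 : 0 < y) (h1 : y < 1 / 2) : 0 < Qinv y := by
  by_contra! h
  have := half_le_Qfun h
  rw [Qfun_Qinv h0 h1] at this
  linarith

end Gaussian

section LogTaylor

lemma tendsto_mul_log_sub (c : ℝ) :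
    Tendsto (fun n : ℕ => n * (Real.log (1 + c / √n) - c / √n)) atTop (𝓝 (-(c ^ 2 / 2))) := by
  have hc : Tendsto (fun n : ℕ => c / √n) atTop (𝓝 0) := tendsto_sqrt_natCast.const_div_atTop c
  have hlim : Tendsto (fun n : ℕ => 2 * |c| ^ 2 * |c / √n|) atTop (𝓝 0) := by
    have := hc.abs.const_mul (2 * |c| ^ 2)
    rwa [abs_zero, mul_zero] at this
  refine tendsto_iff_norm_sub_tendsto_zero.2 (squeeze_zero' (Eventually.of_forall fun n =>
    norm_nonneg _) ?_ hlim)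
  have hsmall : ∀ᶠ n : ℕ in atTop, |c / √n| < 1 / 2 := by
    have := hc.abs
    rw [abs_zero] at this
    exact this.eventually (gt_mem_nhds (by norm_num))
  filter_upwards [hsmall, eventually_gt_atTop 0] with n hn hn0
  have hn1 : (0 : ℝ) < n := Nat.cast_pos.2 hn0
  have hx : n * (c / √n) ^ 2 = c ^ 2 := by
    rw [div_pow, Real.sq_sqrt hn1.le]; field_simp
  set x := c / √n with hxdef
  have h := Real.abs_log_sub_add_sum_range_le (x := -x) (by rw [abs_neg]; linarith) 2
  simp only [sum_range_succ, sum_range_zero, abs_neg, sub_neg_eq_add] at h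
  have e : n * (Real.log (1 + x) - x) - -(c ^ 2 / 2)
      = n * (0 + (-x) ^ (0 + 1) / ((0 : ℕ) + 1) + (-x) ^ (1 + 1) / ((1 : ℕ) + 1)
        + Real.log (1 + x)) := by
    rw [← hx]; push_cast; ring
  rw [e, Real.norm_eq_abs, abs_mul, abs_of_pos hn1]
  have h5 : |x| ^ (2 + 1) / (1 - |x|) ≤ 2 * |x| ^ 3 := by
    rw [div_le_iff₀ (by linarith)]
    have h6 := mul_nonneg (pow_nonneg (abs_nonneg x) 3) (by linarith : 0 ≤ 1 - 2 * |x|)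
    calc |x| ^ (2 + 1) ≤ |x| ^ 3 + |x| ^ 3 * (1 - 2 * |x|) := le_add_of_nonneg_right h6
      _ = _ := by ring
  calc _ ≤ n * (2 * |x| ^ 3) := mul_le_mul_of_nonneg_left (h.trans h5) hn1.le
    _ = 2 * (n * x ^ 2) * |x| := by rw [← sq_abs x]; ring
    _ = _ := by rw [hx, sq_abs]

lemma tendsto_sqrt_mul_log (c : ℝ) :
    Tendsto (fun n : ℕ => √n * Real.log (1 + c / √n)) atTop (𝓝 c) := by
  have h := (tendsto_mul_log_sub c).mul (tendsto_sqrt_natCast.const_div_atTop 1)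
  rw [mul_zero] at h
  have h2 := h.add_const c
  rw [zero_add] at h2
  refine h2.congr' ?_
  filter_upwards [eventually_gt_atTop 0] with n hn0
  have hn1 : (0 : ℝ) < n := Nat.cast_pos.2 hn0
  have hs : 0 < √(n : ℝ) := Real.sqrt_pos.2 hn1
  have hx : (n : ℝ) = √n * √n := (Real.mul_self_sqrt hn1.le).symm
  nth_rewrite 1 [hx]
  field_simp
  ring

end LogTaylor

end CovertComm

namespace CovertComm

open Finset Filter Topology

section Covertness

/-- The normalised likelihood-ratio deviation of a single bit observed by James. -/
noncomputable def stdDev (q : ℝ) (b : Bool) : ℝ :=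
  if b then √(q * (1 - q)) / q else -(√(q * (1 - q)) / (1 - q))

variable {q : ℝ}

lemma sum_ber_mul_stdDev (hq0 : 0 < q) (hq1 : q < 1) : ∑ b, ber q b * stdDev q b = 0 := by
  have : 1 - q ≠ 0 := by linarith
  simp [ber, stdDev]; field_simp; ring

lemma sum_ber_mul_stdDev_sq (hq0 : 0 < q) (hq1 : q < 1) :
    ∑ b, ber q b * stdDev q b ^ 2 = 1 := by
  have h1 : 0 < 1 - q := by linarith
  simp only [Fintype.sum_bool, ber, stdDev, if_true, Bool.false_eq_true, if_false, neg_sq, div_pow,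
    Real.sq_sqrt (mul_pos hq0 h1).le]
  field_simp; ring

lemma lr_eq_stdDev (hq0 : 0 < q) (hq1 : q < 1) (b : Bool) :
    lr q b = 1 + (1 - 2 * q) / √(q * (1 - q)) * stdDev q b := by
  have h1 : 0 < 1 - q := by linarith
  have hw : √(q * (1 - q)) ≠ 0 := (Real.sqrt_pos.2 (mul_pos hq0 h1)).ne'
  cases b <;> simp [lr, stdDev] <;> field_simp <;> ring

lemma eq_affine_stdDev (hq0 : 0 < q) (hq1 : q < 1) (f : Bool → ℝ) (b : Bool) :
    f b = ∑ a, ber q a * f a + (f true - f false) * √(q * (1 - q)) * stdDev q b := by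
  have h1 : 0 < 1 - q := by linarith
  have hw : √(q * (1 - q)) * √(q * (1 - q)) = q * (1 - q) := Real.mul_self_sqrt (mul_pos hq0 h1).le
  have ht : √(q * (1 - q)) * stdDev q true = 1 - q := by
    simp only [stdDev, if_true]
    rw [← mul_div_assoc, hw]; field_simp
  have hf : √(q * (1 - q)) * stdDev q false = -q := by
    simp only [stdDev, Bool.false_eq_true, if_false]
    rw [mul_neg, ← mul_div_assoc, hw]; field_simp
  rw [mul_assoc]
  cases b
  · rw [hf]; simp [ber]; ring
  · rw [ht]; simp [ber]; ring

lemma tendsto_mean_min_avgLR (hq0 : 0 < q) (hq2 : q < 1 / 2) {t : ℝ} (ht : 0 < t) :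
    Tendsto (fun n : ℕ => ∑ z : BV n, noiseP q z * min 1 (avgLR q (t / √n) z)) atTop
      (𝓝 (2 * Qfun (t * ((1 - 2 * q) / √(q * (1 - q))) / 2))) := by
  have hq1 : q < 1 := by linarith
  have h1 : 0 < 1 - q := by linarith
  have hw0 : 0 < √(q * (1 - q)) := Real.sqrt_pos.2 (mul_pos hq0 h1)
  set m := (1 - 2 * q) / √(q * (1 - q)) with hm
  have hm0 : 0 < m := div_pos (by linarith) hw0
  set μ := t * m with hμ
  have hμ0 : 0 < μ := mul_pos ht hm0
  let ℓ : ℕ → Bool → ℝ := fun n b => Real.log (1 + μ * stdDev q b / √n)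
  let x : ℕ → ℝ := fun n => ∑ b, ber q b * (n * (ℓ n b - μ * stdDev q b / √n))
  let y : ℕ → ℝ := fun n => (√n * ℓ n true - √n * ℓ n false) * √(q * (1 - q))
  have hx : Tendsto x atTop (𝓝 (-(μ ^ 2 / 2))) := by
    have h : Tendsto x atTop (𝓝 (∑ b, ber q b * (-((μ * stdDev q b) ^ 2 / 2)))) :=
      tendsto_finsetSum _ fun b _ => (tendsto_mul_log_sub (μ * stdDev q b)).const_mul _
    have e : ∑ b, ber q b * (-((μ * stdDev q b) ^ 2 / 2))
        = -(μ ^ 2 / 2) * ∑ b, ber q b * stdDev q b ^ 2 := by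
      rw [mul_sum]
      exact sum_congr rfl fun b _ => by ring
    rwa [e, sum_ber_mul_stdDev_sq hq0 hq1, mul_one] at h
  have hy : Tendsto y atTop (𝓝 μ) := by
    have h := ((tendsto_sqrt_mul_log (μ * stdDev q true)).sub
      (tendsto_sqrt_mul_log (μ * stdDev q false))).mul_const (√(q * (1 - q)))
    have e : (μ * stdDev q true - μ * stdDev q false) * √(q * (1 - q)) = μ := by
      have hw : √(q * (1 - q)) ^ 2 = q * (1 - q) := Real.sq_sqrt (mul_pos hq0 h1).le
      simp only [stdDev, if_true, Bool.false_eq_true, if_false]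
      field_simp
      rw [hw]; ring
    rwa [e] at h
  have h := tendsto_mean_min_exp_affine hq0.le hq1.le (sum_ber_mul_stdDev hq0 hq1)
    (sum_ber_mul_stdDev_sq hq0 hq1) hx hy
  rw [integral_min_exp_gaussian hμ0] at h
  refine h.congr' ?_
  filter_upwards [tendsto_sqrt_natCast.eventually_ge_atTop (max 1 t)] with n hn
  have hn1 : 0 < √(n : ℝ) := one_pos.trans_le ((le_max_left _ _).trans hn)
  have hρ : t / √n ≤ 1 := (div_le_one hn1).2 ((le_max_right _ _).trans hn)
  have hρ0 : 0 < t / √n := by positivity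
  have hlet : ∀ b, 1 - t / √n + t / √n * lr q b = Real.exp (ℓ n b) := by
    intro b
    have e : 1 - t / √n + t / √n * lr q b = 1 + μ * stdDev q b / √n := by
      rw [lr_eq_stdDev hq0 hq1, ← hm, hμ]; ring
    simp only [ℓ]
    rw [e, Real.exp_log]
    rw [← e]
    have := mul_pos hρ0 (lr_pos hq0 hq1 b)
    linarith
  have hx' : x n = n * ∑ b, ber q b * ℓ n b := by
    have e : x n = n * ∑ b, ber q b * ℓ n b - n * (μ / √n) * ∑ b, ber q b * stdDev q b := by
      simp only [x]
      rw [mul_sum, mul_sum, ← sum_sub_distrib]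
      exact sum_congr rfl fun b _ => by ring
    rw [e, sum_ber_mul_stdDev hq0 hq1]; ring
  refine sum_congr rfl fun z _ => ?_
  congr 2
  rw [avgLR, prod_congr rfl fun i _ => hlet (z i), ← Real.exp_sum]
  congr 1
  rw [sum_congr rfl fun i _ => eq_affine_stdDev hq0 hq1 (ℓ n) (z i), sum_add_distrib, ← mul_sum,
    sum_const, card_univ, Fintype.card_fin, nsmul_eq_mul, hx', normSum]
  simp only [y]
  field_simp

end Covertness

section Assembly

variable {p q εd : ℝ}

lemma tpar_pos (hq0 : 0 < q) (hq2 : q < 1 / 2) (he0 : 0 < εd) (he1 : εd < 1) : 0 < tpar q εd := by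
  have h1 : 0 < 1 - q := by linarith
  have h2 : 0 < 1 - 2 * q := by linarith
  have := Qinv_pos (y := (1 - εd) / 2) (by linarith) (by linarith)
  rw [tpar]
  positivity

lemma tendsto_mean_min_avgLR_tpar (hq0 : 0 < q) (hq2 : q < 1 / 2) (he0 : 0 < εd) (he1 : εd < 1) :
    Tendsto (fun n : ℕ => ∑ z : BV n, noiseP q z * min 1 (avgLR q (tpar q εd / √n) z)) atTop
      (𝓝 (1 - εd)) := by
  have h := tendsto_mean_min_avgLR hq0 hq2 (tpar_pos hq0 hq2 he0 he1)
  have h1 : 0 < 1 - q := by linarith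
  have h2 : 0 < 1 - 2 * q := by linarith
  have hw0 : 0 < √(q * (1 - q)) := Real.sqrt_pos.2 (mul_pos hq0 h1)
  have e : tpar q εd * ((1 - 2 * q) / √(q * (1 - q))) / 2 = Qinv ((1 - εd) / 2) := by
    rw [tpar]; field_simp
  rw [e, Qfun_Qinv (by linarith) (by linarith)] at h
  convert h using 2
  ring

lemma covertGap_le_one {n N Δ : ℕ} (C : Code n N Δ) :
    covertGap q C ≤ 1 := by
  refine (ciInf_le (Set.finite_range _).bddBelow fun _ => true).trans ?_
  simp [PFA, PMD, sum_noiseP]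

/-- Any key sizes growing at rate at least `σ√n` suffice. -/
lemma achievable_of_key_rate {σ : ℝ} (hp0 : 0 < p) (hpq : p < q) (hq2 : q < 1 / 2) (he0 : 0 < εd)
    (he1 : εd < 1) (hσ : 0 < σ) (hI : IJ q < IB p q + σ / tpar q εd) {δ : ℝ} (hδ : 0 < δ)
    {Δ : ℕ → ℕ} (hΔ : ∀ᶠ n : ℕ in atTop, σ * √n ≤ Δ n) :
    ∃ (N : ℕ → ℕ) (C : ∀ n : ℕ, Code n (N n) (Δ n)), IsCovertSeq q εd N Δ C ∧
      (∀ᶠ n : ℕ in atTop, tpar q εd * IB p q - δ ≤ Real.logb 2 (N n) / √n) ∧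
      Tendsto (fun n => Perr p q (C n)) atTop (𝓝 0) := by
  have hq0 : 0 < q := hp0.trans hpq
  have hq1 : q < 1 := by linarith
  have hl2 : 0 < Real.log 2 := Real.log_pos one_lt_two
  have ht := tpar_pos hq0 hq2 he0 he1
  have hB := divB_pos hp0 hpq hq1
  set t := tpar q εd with htdef
  have hJ0 : 0 < t * divB p q + σ * Real.log 2 - t * divJ q := by
    have h1 := mul_lt_mul_of_pos_left hI (mul_pos ht hl2)
    have h2 : t * Real.log 2 * (IB p q + σ / t) = t * divB p q + σ * Real.log 2 := by
      rw [divB_eq hp0 hpq hq1]; field_simp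
    rw [h2] at h1
    rw [divJ_eq hq0 hq1]
    linarith
  obtain ⟨δ₁, hδ₁, hδ₁'⟩ := exists_between (lt_min (mul_pos hδ hl2)
    (lt_min (mul_pos ht hB) hJ0))
  obtain ⟨ν, hν, hev⟩ := exists_codes hp0 hpq hq2 ht (mul_pos hσ hl2) hδ₁
    (hδ₁'.trans_le ((min_le_right _ _).trans (min_le_left _ _)))
    (hδ₁'.trans_le ((min_le_right _ _).trans (min_le_right _ _))) (Δ := Δ)
    (hΔ.mono fun n hn => by nlinarith)
  have hδ₁δ : δ₁ ≤ δ * Real.log 2 := hδ₁'.le.trans (min_le_left _ _)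
  have hsel : ∀ n : ℕ, ∃ NC : Σ N, Code n N (Δ n),
      (∃ (N : ℕ) (C : Code n N (Δ n)), Real.exp (√n * (t * divB p q - δ₁)) ≤ N ∧
        Perr p q C ≤ ν n ∧ ∑ z : BV n, noiseP q z * min 1 (avgLR q (t / √n) z) - ν n
          ≤ covertGap q C) →
      Real.exp (√n * (t * divB p q - δ₁)) ≤ NC.1 ∧ Perr p q NC.2 ≤ ν n ∧
        ∑ z : BV n, noiseP q z * min 1 (avgLR q (t / √n) z) - ν n ≤ covertGap q NC.2 := by
    intro n
    by_cases h : ∃ (N : ℕ) (C : Code n N (Δ n)), Real.exp (√n * (t * divB p q - δ₁)) ≤ N ∧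
        Perr p q C ≤ ν n ∧ ∑ z : BV n, noiseP q z * min 1 (avgLR q (t / √n) z) - ν n
          ≤ covertGap q C
    · obtain ⟨N, C, hC⟩ := h
      exact ⟨⟨N, C⟩, fun _ => hC⟩
    · exact ⟨⟨0, ⟨fun _ _ _ => false, fun _ _ => none⟩⟩, fun h' => absurd h' h⟩
  choose NC hNC using hsel
  have hgood := hev.mono fun n hn => hNC n hn
  refine ⟨fun n => (NC n).1, fun n => (NC n).2, ?_, ?_, ?_⟩
  · have hlim := (tendsto_mean_min_avgLR_tpar hq0 hq2 he0 he1).sub hν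
    rw [sub_zero] at hlim
    rw [IsCovertSeq, ← hlim.liminf_eq]
    exact liminf_le_liminf (hgood.mono fun n hn => hn.2.2) hlim.isBoundedUnder_ge
      (isCoboundedUnder_ge_of_le _ fun n => covertGap_le_one _)
  · filter_upwards [hgood, eventually_gt_atTop 0] with n hn hn0
    have hs : 0 < √(n : ℝ) := Real.sqrt_pos.2 (Nat.cast_pos.2 hn0)
    have h1 : √n * (t * divB p q - δ₁) ≤ Real.log (NC n).1 :=
      (Real.le_log_iff_exp_le ((Real.exp_pos _).trans_le hn.1)).2 hn.1
    rw [le_div_iff₀ hs, Real.logb, le_div_iff₀ hl2]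
    refine le_trans ?_ h1
    rw [divB_eq hp0 hpq hq1]
    have h2 := mul_le_mul_of_nonneg_left hδ₁δ hs.le
    linarith
  · exact squeeze_zero' (Eventually.of_forall fun n => Perr_nonneg hq0.le hq1.le _)
      (hgood.mono fun n hn => hn.2.1) hν

end Assembly

end CovertComm

namespace CovertComm

/-- Theorem 3, moderate- and large-sized key regimes.
If `0 < p < q < 1/2`, `εd ∈ (0,1)`, and `σ > 0` satisfies
`I_B(p,q) + σ/t(q,εd) > I_J(q)`, then for every `δ > 0` the relative
throughput `t(q,εd)·I_B(p,q) − δ` is achievable with key sizes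
`Δ(n) = ⌈σ√n + 6 log₂ n⌉`.  In particular, for any key sizes with
`Δ(n)/√n → ∞` the same holds (for all `0 < p < q < 1/2`, with no condition
relating `I_B`, `I_J` and `σ`). -/
theorem covert_achievability_moderate_key (p q εd σ : ℝ)
    (hp0 : 0 < p) (hpq : p < q) (hq2 : q < 1 / 2)
    (he0 : 0 < εd) (he1 : εd < 1) (hσ : 0 < σ)
    (hI : IJ q < IB p q + σ / tpar q εd) :
    ∀ δ : ℝ, 0 < δ →
      (∃ (N : ℕ → ℕ)
        (C : ∀ n : ℕ,
          Code n (N n) (⌈σ * Real.sqrt n + 6 * Real.logb 2 (n : ℝ)⌉₊)),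
        IsCovertSeq q εd N
          (fun n => ⌈σ * Real.sqrt n + 6 * Real.logb 2 (n : ℝ)⌉₊) C ∧
        (∀ᶠ n : ℕ in Filter.atTop,
          tpar q εd * IB p q - δ ≤ Real.logb 2 (N n) / Real.sqrt n) ∧
        Filter.Tendsto (fun n => Perr p q (C n)) Filter.atTop (nhds 0)) ∧
      (∀ Δ : ℕ → ℕ,
        Filter.Tendsto (fun n => (Δ n : ℝ) / Real.sqrt n) Filter.atTop
          Filter.atTop →
        ∃ (N : ℕ → ℕ) (C : ∀ n : ℕ, Code n (N n) (Δ n)),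
          IsCovertSeq q εd N Δ C ∧
          (∀ᶠ n : ℕ in Filter.atTop,
            tpar q εd * IB p q - δ ≤ Real.logb 2 (N n) / Real.sqrt n) ∧
          Filter.Tendsto (fun n => Perr p q (C n)) Filter.atTop (nhds 0)) := by
  intro δ hδ
  refine ⟨achievable_of_key_rate hp0 hpq hq2 he0 he1 hσ hI hδ ?_, fun Δ hΔ =>
    achievable_of_key_rate hp0 hpq hq2 he0 he1 hσ hI hδ ?_⟩
  · filter_upwards [Filter.eventually_ge_atTop 1] with n hn
    have hlog : 0 ≤ Real.logb 2 (n : ℝ) :=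
      Real.logb_nonneg one_lt_two (Nat.one_le_cast.2 hn)
    exact (by linarith : σ * √(n : ℝ) ≤ σ * √n + 6 * Real.logb 2 (n : ℝ)).trans (Nat.le_ceil _)
  · filter_upwards [hΔ.eventually_ge_atTop σ, Filter.eventually_gt_atTop 0] with n hn hn0
    exact (le_div_iff₀ (Real.sqrt_pos.2 (Nat.cast_pos.2 hn0))).1 hn

end CovertComm
end

section
/- Normalized mutual information of the induced binary asymmetric channel at low input weight: let 0 < p < q < 1/2, set b = p(1−q)/q ∈ (0,1), and for ρ ∈ (0,1) define I(ρ) = h(ρ(1−b) + (1−ρ)p) − ρ·h(b) − (1−ρ)·h(p), the mutual information of the binary asymmetric channel with crossover probabilities W(1|0) = p and W(0|1) = b under a Bernoulli(ρ) input. Then lim_{ρ → 0⁺} I(ρ)/ρ = (p(q−1)/q)·log₂((q−p+pq)(1−p)/(p²(1−q))) + log₂((q−p+pq)/(pq)) = I_B(p,q). -/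
/-!
Normalized mutual information of the induced binary asymmetric channel
(crossover probabilities `W(1|0) = p`, `W(0|1) = b = p(1−q)/q`) at low input
weight.
-/

/-- The binary entropy function (base-2); `Real.logb 2 0 = 0`, so this agrees
with the convention `h(0) = h(1) = 0`. -/
noncomputable def binEnt (x : ℝ) : ℝ :=
  -(x * Real.logb 2 x) - (1 - x) * Real.logb 2 (1 - x)

/-- `I_B(p,q)`. -/
noncomputable def IB (p q : ℝ) : ℝ :=
  p * (q - 1) / q *
      Real.logb 2 ((q - p + p * q) * (1 - p) / (p ^ 2 * (1 - q)))
    + Real.logb 2 ((q - p + p * q) / (p * q))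

/-- Derivative of the base-2 binary entropy at an interior point. -/
theorem hasDerivAt_binEnt {x : ℝ} (h0 : 0 < x) (h1 : x < 1) :
    HasDerivAt binEnt (Real.logb 2 (1 - x) - Real.logb 2 x) x := by
  have hx := (hasDerivAt_id x).mul ((Real.hasDerivAt_log h0.ne').div_const (Real.log 2))
  have hs : HasDerivAt (fun y : ℝ => 1 - y) (-1) x := by
    simpa using (hasDerivAt_id x).const_sub 1
  have h1' : 1 - x ≠ 0 := by linarith
  have hy := hs.mul ((hs.log h1').div_const (Real.log 2))
  have h2 : Real.log 2 ≠ 0 := (Real.log_pos one_lt_two).ne'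
  refine (hx.neg.sub hy).congr_deriv ?_
  simp only [Real.logb, id]
  field_simp
  ring

/-- The slope of `ρ ↦ I(ρ)` at zero for a general binary asymmetric channel. -/
theorem tendsto_mutual_info_div {p b : ℝ} (h0 : 0 < p) (h1 : p < 1) :
    Filter.Tendsto
      (fun ρ : ℝ => (binEnt (ρ * (1 - b) + (1 - ρ) * p) - ρ * binEnt b
        - (1 - ρ) * binEnt p) / ρ)
      (nhdsWithin 0 (Set.Ioi 0))
      (nhds ((Real.logb 2 (1 - p) - Real.logb 2 p) * (1 - b - p) - binEnt b + binEnt p)) := by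
  have hin : HasDerivAt (fun ρ : ℝ => ρ * (1 - b) + (1 - ρ) * p) (1 - b - p) 0 :=
    (((hasDerivAt_id (0 : ℝ)).mul_const (1 - b)).add
      (((hasDerivAt_id (0 : ℝ)).const_sub 1).mul_const p)).congr_deriv (by ring)
  have hent := (hasDerivAt_binEnt h0 h1).comp_of_eq 0 hin (by ring)
  have hlim := hent.tendsto_slope_zero_right
  refine ((hlim.sub_const (binEnt b)).add_const (binEnt p)).congr' ?_
  filter_upwards [self_mem_nhdsWithin] with ρ hρ
  have hρ' : ρ ≠ 0 := ne_of_gt hρ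
  simp only [Function.comp_apply, smul_eq_mul, zero_add, zero_mul, sub_zero, one_mul]
  field_simp
  ring

/-- For `0 < p < q < 1/2` and `b = p(1−q)/q ∈ (0,1)`, the
mutual information of the binary asymmetric channel with `W(1|0) = p`,
`W(0|1) = b` under a Bernoulli(ρ) input is
`I(ρ) = h(ρ(1−b) + (1−ρ)p) − ρ·h(b) − (1−ρ)·h(p)`, and
`lim_{ρ→0⁺} I(ρ)/ρ = I_B(p,q)`. -/
theorem bac_mutual_info_slope (p q : ℝ) (hp0 : 0 < p) (hpq : p < q)
    (hq2 : q < 1 / 2) :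
    Filter.Tendsto
      (fun ρ : ℝ =>
        (binEnt (ρ * (1 - p * (1 - q) / q) + (1 - ρ) * p)
            - ρ * binEnt (p * (1 - q) / q) - (1 - ρ) * binEnt p) / ρ)
      (nhdsWithin 0 (Set.Ioi 0)) (nhds (IB p q)) ∧
    IB p q = p * (q - 1) / q *
        Real.logb 2 ((q - p + p * q) * (1 - p) / (p ^ 2 * (1 - q)))
      + Real.logb 2 ((q - p + p * q) / (p * q)) := by
  refine ⟨?_, rfl⟩
  have hq0 : 0 < q := hp0.trans hpq
  have hp1 : p < 1 := by linarith
  have hs : 0 < q - p + p * q := by nlinarith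
  have hq1 : 0 < 1 - q := by linarith
  have hp1' : 0 < 1 - p := by linarith
  have hb : 1 - p * (1 - q) / q = (q - p + p * q) / q := by
    field_simp
    ring
  convert tendsto_mutual_info_div (b := p * (1 - q) / q) hp0 hp1 using 2
  unfold IB binEnt
  rw [hb, Real.logb_div (mul_pos hs hp1').ne' (by positivity),
    Real.logb_mul hs.ne' hp1'.ne', Real.logb_mul (by positivity) hq1.ne',
    Real.logb_pow, Real.logb_div hs.ne' (by positivity), Real.logb_mul hp0.ne' hq0.ne',
    Real.logb_div (by positivity) hq0.ne', Real.logb_mul hp0.ne' hq1.ne',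
    Real.logb_div hs.ne' hq0.ne']
  push_cast
  field_simp
  ring
end
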